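/- arXiv:2110.05716 — 2 statements merged into one kernel-verified Lean document; each statement's English description precedes it below -/
import Mathlib

section
/- Discrete Burkholder–Davis–Gundy inequality (Lemma 2.7): let k, m, N ≥ 1, T > 0, p ≥ 2, and let G_0 ⊆ G_1 ⊆ ⋯ ⊆ G_N be sub-σ-algebras of F. For l ∈ {0,…,N−1} let Z_l : Ω → ℝ^{k×m} be G_l-measurable with ‖Z_l e_i‖_{L^p(Ω;ℝ^k)} < ∞ for each i, and let ΔW_l : Ω → ℝ^m be G_{l+1}-measurable, independent of G_l, with law equal to the m-fold product of the real Gaussian measure with mean 0 and variance T/N. Then for every n ∈ {0,…,N}: ‖ sup_{0≤j≤n} ‖Σ_{l=0}^{j−1} Z_l ΔW_l‖ ‖_{L^p(Ω;ℝ)} ≤ p·( Σ_{l=0}^{n−1} Σ_{i=1}^m ‖Z_l e_i‖²_{L^p(Ω;ℝ^k)} · (T/N) )^{1/2}. -/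
open MeasureTheory ProbabilityTheory Real Finset
open scoped RealInnerProductSpace ENNReal NNReal

noncomputable section

abbrev Vec (n : ℕ) : Type := EuclideanSpace ℝ (Fin n)

/-- The `d × m` matrix with columns `g j x`, viewed as a continuous linear map `ℝ^m → ℝ^d`. -/
def Gclm {d m : ℕ} (g : Fin m → Vec d → Vec d) (x : Vec d) : Vec m →L[ℝ] Vec d :=
  LinearMap.toContinuousLinearMap
  { toFun := fun w => ∑ j, w j • g j x
    map_add' := by
      intro w w'
      simp [PiLp.add_apply, add_smul, Finset.sum_add_distrib]
    map_smul' := by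
      intro c w
      simp [PiLp.smul_apply, smul_smul, Finset.smul_sum] }

/-- `L^{j₁} g_{j₂} (x) = (Dg_{j₂})(x) · g_{j₁}(x)`. -/
def Lg {d m : ℕ} (g : Fin m → Vec d → Vec d) (j₁ j₂ : Fin m) (x : Vec d) : Vec d :=
  fderiv ℝ (g j₂) x (g j₁ x)

/-- One step of the semi-tamed Milstein scheme with stepsize `h`, drift parts `ph` (Lipschitz)
and `ps` (tamed), diffusion columns `g`, current state `y` and Brownian increment `w`. -/
def milstep {d m : ℕ} (h : ℝ) (ph ps : Vec d → Vec d) (g : Fin m → Vec d → Vec d)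
    (y : Vec d) (w : Vec m) : Vec d :=
  y + h • ph y + (h / (1 + ‖ps y‖ * h)) • ps y + Gclm g y w
    + (2⁻¹ : ℝ) • ∑ j₁, ∑ j₂, (w j₁ * w j₂ - (if j₁ = j₂ then h else 0)) • Lg g j₁ j₂ y

/-- The quantity `α` associated with a state `y` and an increment `w`. -/
def alph {d m : ℕ} (h : ℝ) (g : Fin m → Vec d → Vec d) (y : Vec d) (w : Vec m) : ℝ :=
  if 1 ≤ ‖y‖ then
    ⟪‖y‖⁻¹ • y, ‖y‖⁻¹ • (Gclm g y w)⟫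
      + ⟪‖y‖⁻¹ • y,
          (2 * ‖y‖)⁻¹ • ∑ j₁, ∑ j₂, (w j₁ * w j₂ - (if j₁ = j₂ then h else 0)) • Lg g j₁ j₂ y⟫
  else 0

/-- The constant `λ`. -/
def lamc {d m : ℕ} (T K : ℝ) (ph ps : Vec d → Vec d) (g : Fin m → Vec d → Vec d) : ℝ :=
  (1 + 4 * T * K + 2 * T * (‖ph 0‖ + ‖ps 0‖) + 2 * K + 2 * ‖Gclm g 0‖
    + (m : ℝ) ^ 2 * (T + 1) * (K + ⨆ j : Fin m × Fin m, ‖Lg g j.1 j.2 0‖)) ^ 2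

/-- The dominating process `D_n`, given `λ`, `‖ξ‖`, the squared increment norms and the `α`'s. -/
def Dproc (lam ξnorm : ℝ) (w2 al : ℕ → ℝ) (n : ℕ) : ℝ :=
  (lam + ξnorm) * Real.exp (lam +
    (Finset.range (n + 1)).sup' Finset.nonempty_range_add_one
      (fun u => ∑ k ∈ Finset.Ico u n, (lam * w2 k + al k)))

end

noncomputable section

/-- For `1 ≤ r`, `(1 + t) ^ r * (1 - r t) ≤ (1 - t) ^ r * (1 + r t)` on `[0, 1]`. -/
lemma one_add_rpow_mul_one_sub_le {r t : ℝ} (hr : 1 ≤ r) (ht0 : 0 ≤ t) (ht1 : t ≤ 1) :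
    (1 + t) ^ r * (1 - r * t) ≤ (1 - t) ^ r * (1 + r * t) := by
  have hmono : MonotoneOn (fun s : ℝ => (1 - s) ^ r * (1 + r * s) - (1 + s) ^ r * (1 - r * s))
      (Set.Icc 0 1) := by
    refine monotoneOn_of_hasDerivWithinAt_nonneg
      (f' := fun s => r * (r + 1) * s * ((1 + s) ^ (r - 1) - (1 - s) ^ (r - 1)))
      (convex_Icc 0 1) ?_ ?_ ?_
    · refine Continuous.continuousOn ?_
      have h1 : Continuous fun s : ℝ => (1 - s) ^ r :=
        (continuous_const.sub continuous_id).rpow_const (fun _ => Or.inr (by linarith))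
      have h2 : Continuous fun s : ℝ => (1 + s) ^ r :=
        (continuous_const.add continuous_id).rpow_const (fun _ => Or.inr (by linarith))
      fun_prop
    · intro s hs
      rw [interior_Icc] at hs
      have hs1 : 0 < 1 - s := by linarith [hs.2]
      have hs2 : 0 < 1 + s := by linarith [hs.1]
      have h1 : HasDerivAt (fun s : ℝ => (1 - s) ^ r) (-1 * r * (1 - s) ^ (r - 1)) s :=
        ((hasDerivAt_id s).const_sub 1).rpow_const (Or.inl hs1.ne')
      have h2 : HasDerivAt (fun s : ℝ => (1 + s) ^ r) (1 * r * (1 + s) ^ (r - 1)) s :=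
        ((hasDerivAt_id s).const_add 1).rpow_const (Or.inl hs2.ne')
      have h3 : HasDerivAt (fun s : ℝ => 1 + r * s) (r * 1) s :=
        ((hasDerivAt_id s).const_mul r).const_add 1
      have h4 : HasDerivAt (fun s : ℝ => 1 - r * s) (-(r * 1)) s :=
        ((hasDerivAt_id s).const_mul r).const_sub 1
      refine (((h1.mul h3).sub (h2.mul h4)).congr_deriv ?_).hasDerivWithinAt
      have e1 : (1 - s) ^ r = (1 - s) ^ (r - 1) * (1 - s) := by
        rw [← Real.rpow_add_one hs1.ne']; ring_nf
      have e2 : (1 + s) ^ r = (1 + s) ^ (r - 1) * (1 + s) := by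
        rw [← Real.rpow_add_one hs2.ne']; ring_nf
      rw [e1, e2]
      ring
    · intro s hs
      rw [interior_Icc] at hs
      have : (1 - s) ^ (r - 1) ≤ (1 + s) ^ (r - 1) :=
        Real.rpow_le_rpow (by linarith [hs.2]) (by linarith [hs.1]) (by linarith)
      have h0 : 0 ≤ r * (r + 1) * s := by
        have := hs.1.le
        positivity
      exact mul_nonneg h0 (by linarith)
  have := hmono (Set.left_mem_Icc.2 zero_le_one) ⟨ht0, ht1⟩ ht0
  simp at this
  linarith

/-- The normalized two-point inequality on `[0, 1]`. -/
lemma one_add_rpow_add_one_sub_rpow_le {p t : ℝ} (hp : 2 ≤ p) (ht0 : 0 ≤ t) (ht1 : t ≤ 1) :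
    (1 + t) ^ p + (1 - t) ^ p ≤ 2 * (1 + (p - 1) * t ^ 2) ^ (p / 2) := by
  have hpos : ∀ s : ℝ, 0 < 1 + (p - 1) * s ^ 2 := fun s => by
    have : 0 ≤ (p - 1) * s ^ 2 := mul_nonneg (by linarith) (sq_nonneg s)
    linarith
  have hanti : AntitoneOn (fun s : ℝ => ((1 + s) ^ p + (1 - s) ^ p)
      * (1 + (p - 1) * s ^ 2) ^ (-(p / 2))) (Set.Icc 0 1) := by
    refine antitoneOn_of_hasDerivWithinAt_nonpos
      (f' := fun s => p * (1 + (p - 1) * s ^ 2) ^ (-(p / 2) - 1)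
        * ((1 + s) ^ (p - 1) * (1 - (p - 1) * s) - (1 - s) ^ (p - 1) * (1 + (p - 1) * s)))
      (convex_Icc 0 1) ?_ ?_ ?_
    · refine Continuous.continuousOn ?_
      have h1 : Continuous fun s : ℝ => (1 - s) ^ p :=
        (continuous_const.sub continuous_id).rpow_const (fun _ => Or.inr (by linarith))
      have h2 : Continuous fun s : ℝ => (1 + s) ^ p :=
        (continuous_const.add continuous_id).rpow_const (fun _ => Or.inr (by linarith))
      have h3 : Continuous fun s : ℝ => (1 + (p - 1) * s ^ 2) ^ (-(p / 2)) :=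
        Continuous.rpow_const (by fun_prop) (fun s => Or.inl (hpos s).ne')
      fun_prop
    · intro s hs
      rw [interior_Icc] at hs
      have hs1 : 0 < 1 - s := by linarith [hs.2]
      have hs2 : 0 < 1 + s := by linarith [hs.1]
      have h1 : HasDerivAt (fun s : ℝ => (1 - s) ^ p) (-1 * p * (1 - s) ^ (p - 1)) s :=
        ((hasDerivAt_id s).const_sub 1).rpow_const (Or.inl hs1.ne')
      have h2 : HasDerivAt (fun s : ℝ => (1 + s) ^ p) (1 * p * (1 + s) ^ (p - 1)) s :=
        ((hasDerivAt_id s).const_add 1).rpow_const (Or.inl hs2.ne')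
      have h3 : HasDerivAt (fun s : ℝ => 1 + (p - 1) * s ^ 2) ((p - 1) * (2 * s)) s := by
        simpa using (((hasDerivAt_id s).pow 2).const_mul (p - 1)).const_add 1
      have h4 := h3.rpow_const (p := -(p / 2)) (Or.inl (hpos s).ne')
      refine (((h2.add h1).mul h4).congr_deriv ?_).hasDerivWithinAt
      have e1 : (1 - s) ^ p = (1 - s) ^ (p - 1) * (1 - s) := by
        rw [← Real.rpow_add_one hs1.ne']; ring_nf
      have e2 : (1 + s) ^ p = (1 + s) ^ (p - 1) * (1 + s) := by
        rw [← Real.rpow_add_one hs2.ne']; ring_nf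
      have e3 : (1 + (p - 1) * s ^ 2) ^ (-(p / 2))
          = (1 + (p - 1) * s ^ 2) ^ (-(p / 2) - 1) * (1 + (p - 1) * s ^ 2) := by
        rw [← Real.rpow_add_one (hpos s).ne']; ring_nf
      simp only [Pi.add_apply]
      rw [e1, e2, e3]
      ring
    · intro s hs
      rw [interior_Icc] at hs
      have := one_add_rpow_mul_one_sub_le (r := p - 1) (by linarith) hs.1.le hs.2.le
      have h0 : 0 ≤ p * (1 + (p - 1) * s ^ 2) ^ (-(p / 2) - 1) :=
        mul_nonneg (by linarith) (Real.rpow_nonneg (hpos s).le _)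
      exact mul_nonpos_of_nonneg_of_nonpos h0 (by linarith)
  have := hanti (Set.left_mem_Icc.2 zero_le_one) ⟨ht0, ht1⟩ ht0
  simp only [Real.rpow_neg (hpos _).le] at this
  rw [← div_eq_mul_inv, div_le_iff₀ (Real.rpow_pos_of_pos (hpos t) _)] at this
  norm_num at this
  exact this

/-- The two-point inequality for nonnegative reals. -/
lemma add_rpow_add_abs_sub_rpow_le {p a b : ℝ} (hp : 2 ≤ p) (ha : 0 ≤ a) (hb : 0 ≤ b) :
    (a + b) ^ p + |a - b| ^ p ≤ 2 * (a ^ 2 + (p - 1) * b ^ 2) ^ (p / 2) := by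
  have key : ∀ {a b : ℝ}, 0 ≤ a → 0 ≤ b → b ≤ a →
      (a + b) ^ p + |a - b| ^ p ≤ 2 * (a ^ 2 + (p - 1) * b ^ 2) ^ (p / 2) := by
    intro a b ha hb hab
    rcases ha.eq_or_lt with rfl | ha'
    · obtain rfl : b = 0 := le_antisymm hab hb
      simp [Real.zero_rpow (by linarith : p ≠ 0), Real.zero_rpow (by linarith : p / 2 ≠ 0)]
    · have ht1 : b / a ≤ 1 := (div_le_one ha').2 hab
      have ht0 : 0 ≤ b / a := by positivity
      have h := mul_le_mul_of_nonneg_left (one_add_rpow_add_one_sub_rpow_le hp ht0 ht1)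
        (Real.rpow_nonneg ha p)
      have hpos : 0 ≤ 1 + (p - 1) * (b / a) ^ 2 := by
        have : 0 ≤ (p - 1) * (b / a) ^ 2 := mul_nonneg (by linarith) (sq_nonneg _)
        linarith
      have e1 : a ^ p * (1 + b / a) ^ p = (a + b) ^ p := by
        rw [← Real.mul_rpow ha (by linarith)]; congr 1; field_simp
      have e2 : a ^ p * (1 - b / a) ^ p = |a - b| ^ p := by
        rw [← Real.mul_rpow ha (by linarith), abs_of_nonneg (by linarith)]; congr 1; field_simp
      have e3 : a ^ p * (1 + (p - 1) * (b / a) ^ 2) ^ (p / 2)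
          = (a ^ 2 + (p - 1) * b ^ 2) ^ (p / 2) := by
        have : a ^ p = (a ^ 2) ^ (p / 2) := by
          rw [← Real.rpow_natCast_mul ha]; congr 1; push_cast; ring
        rw [this, ← Real.mul_rpow (sq_nonneg a) hpos]; congr 1; field_simp
      rw [mul_add, e1, e2, mul_left_comm, e3] at h
      exact h
  rcases le_total b a with hab | hab
  · exact key ha hb hab
  · have h := key hb ha hab
    rw [add_comm, abs_sub_comm]
    rw [add_comm b a, add_comm] at h
    refine h.trans ?_
    have : b ^ 2 + (p - 1) * a ^ 2 ≤ a ^ 2 + (p - 1) * b ^ 2 := by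
      nlinarith [mul_nonneg (by linarith : (0 : ℝ) ≤ p - 2) (by nlinarith : 0 ≤ b ^ 2 - a ^ 2)]
    have h0 : 0 ≤ b ^ 2 + (p - 1) * a ^ 2 := by
      have : 0 ≤ (p - 1) * a ^ 2 := mul_nonneg (by linarith) (sq_nonneg _)
      positivity
    gcongr

/-- The symmetric sum `(A + B) ^ q + (A - B) ^ q` increases with `|B|`. -/
lemma add_rpow_add_sub_rpow_mono {q A B C : ℝ} (hq : 1 ≤ q) (hBC : |B| ≤ C) (hCA : C ≤ A) :
    (A + B) ^ q + (A - B) ^ q ≤ (A + C) ^ q + (A - C) ^ q := by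
  obtain ⟨h1, h2⟩ := abs_le.1 hBC
  rcases (abs_nonneg B |>.trans hBC).eq_or_lt with hC | hC
  · obtain rfl : B = 0 := by linarith
    rw [← hC]
  · have hconv := convexOn_rpow hq
    have hs : 0 ≤ (C + B) / (2 * C) := div_nonneg (by linarith) (by linarith)
    have hs' : 0 ≤ (C - B) / (2 * C) := div_nonneg (by linarith) (by linarith)
    have hsum : (C + B) / (2 * C) + (C - B) / (2 * C) = 1 := by field_simp; ring
    have m1 : A + C ∈ Set.Ici (0 : ℝ) := Set.mem_Ici.2 (by linarith)
    have m2 : A - C ∈ Set.Ici (0 : ℝ) := Set.mem_Ici.2 (by linarith)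
    have i1 := hconv.2 m1 m2 hs hs' hsum
    have i2 := hconv.2 m1 m2 hs' hs (by rw [add_comm]; exact hsum)
    simp only [smul_eq_mul] at i1 i2
    rw [show (C + B) / (2 * C) * (A + C) + (C - B) / (2 * C) * (A - C) = A + B by
      field_simp; ring] at i1
    rw [show (C - B) / (2 * C) * (A + C) + (C + B) / (2 * C) * (A - C) = A - B by
      field_simp; ring] at i2
    calc (A + B) ^ q + (A - B) ^ q
        ≤ ((C + B) / (2 * C) + (C - B) / (2 * C)) * ((A + C) ^ q + (A - C) ^ q) := by linarith
      _ = _ := by rw [hsum, one_mul]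

section InnerProductSpace

variable {E : Type*} [NormedAddCommGroup E] [InnerProductSpace ℝ E]

/-- The two-point inequality in an inner product space. -/
lemma norm_add_rpow_add_norm_sub_rpow_le {p : ℝ} (hp : 2 ≤ p) (x y : E) :
    ‖x + y‖ ^ p + ‖x - y‖ ^ p ≤ 2 * (‖x‖ ^ 2 + (p - 1) * ‖y‖ ^ 2) ^ (p / 2) := by
  have hpow : ∀ {a : ℝ}, 0 ≤ a → a ^ p = (a ^ 2) ^ (p / 2) := fun {a} ha => by
    rw [← Real.rpow_natCast_mul ha]; congr 1; push_cast; ring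
  refine le_trans ?_ (add_rpow_add_abs_sub_rpow_le hp (norm_nonneg x) (norm_nonneg y))
  rw [hpow (norm_nonneg _), hpow (norm_nonneg (x - y)), hpow (by positivity),
    hpow (abs_nonneg _), norm_add_sq_real, norm_sub_sq_real, sq_abs]
  have h := add_rpow_add_sub_rpow_mono (q := p / 2) (A := ‖x‖ ^ 2 + ‖y‖ ^ 2) (B := 2 * ⟪x, y⟫)
    (C := 2 * (‖x‖ * ‖y‖)) (by linarith)
    (by
      rw [abs_mul, abs_two]
      exact mul_le_mul_of_nonneg_left (abs_real_inner_le_norm x y) zero_le_two)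
    (by nlinarith [sq_nonneg (‖x‖ - ‖y‖)])
  rw [show ‖x‖ ^ 2 + 2 * ⟪x, y⟫ + ‖y‖ ^ 2 = ‖x‖ ^ 2 + ‖y‖ ^ 2 + 2 * ⟪x, y⟫ by ring,
    show ‖x‖ ^ 2 - 2 * ⟪x, y⟫ + ‖y‖ ^ 2 = ‖x‖ ^ 2 + ‖y‖ ^ 2 - 2 * ⟪x, y⟫ by ring,
    show (‖x‖ + ‖y‖) ^ 2 = ‖x‖ ^ 2 + ‖y‖ ^ 2 + 2 * (‖x‖ * ‖y‖) by ring,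
    show (‖x‖ - ‖y‖) ^ 2 = ‖x‖ ^ 2 + ‖y‖ ^ 2 - 2 * (‖x‖ * ‖y‖) by ring]
  exact h

/-- The two-point inequality, with extended nonnegative norms. -/
lemma enorm_add_rpow_add_enorm_sub_rpow_le {p : ℝ} (hp : 2 ≤ p) (x y : E) :
    ‖x + y‖ₑ ^ p + ‖x - y‖ₑ ^ p
      ≤ 2 * (‖x‖ₑ ^ 2 + ENNReal.ofReal (p - 1) * ‖y‖ₑ ^ 2) ^ (p / 2) := by
  have h := ENNReal.ofReal_le_ofReal (norm_add_rpow_add_norm_sub_rpow_le hp x y)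
  have hp1 : 0 ≤ p - 1 := by linarith
  have hp0 : 0 ≤ p := by linarith
  rw [ENNReal.ofReal_add (by positivity) (by positivity),
    ENNReal.ofReal_mul zero_le_two,
    ← ENNReal.ofReal_rpow_of_nonneg (norm_nonneg _) hp0,
    ← ENNReal.ofReal_rpow_of_nonneg (norm_nonneg _) hp0,
    ← ENNReal.ofReal_rpow_of_nonneg (by positivity) (by positivity),
    ENNReal.ofReal_add (by positivity) (by positivity), ENNReal.ofReal_mul hp1,
    ENNReal.ofReal_pow (norm_nonneg _), ENNReal.ofReal_pow (norm_nonneg _)] at h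
  simpa [ofReal_norm] using h

end InnerProductSpace

/-- The absolute moments of a centered Gaussian, in terms of the Gamma function. -/
lemma integral_abs_rpow_gaussianReal {v : ℝ≥0} (hv : v ≠ 0) {q : ℝ} (hq : -1 < q) :
    ∫ x, |x| ^ q ∂(gaussianReal 0 v)
      = (√(2 * π * v))⁻¹ * ((2 * v : ℝ) ^ ((q + 1) / 2) * Gamma ((q + 1) / 2)) := by
  have hv' : (0 : ℝ) < v := by positivity
  have hb : (0 : ℝ) < (2 * v : ℝ)⁻¹ := by positivity
  rw [integral_gaussianReal_eq_integral_smul hv]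
  have h1 : ∀ x : ℝ, gaussianPDFReal 0 v x • |x| ^ q
      = (√(2 * π * v))⁻¹ * (|x| ^ q * rexp (-(2 * v : ℝ)⁻¹ * |x| ^ (2 : ℝ))) := by
    intro x
    simp only [gaussianPDFReal, smul_eq_mul, sub_zero, Real.rpow_two, sq_abs]
    rw [show -x ^ 2 / (2 * (v : ℝ)) = -(2 * v : ℝ)⁻¹ * x ^ 2 by ring]
    ring
  simp_rw [h1]
  rw [integral_const_mul, integral_comp_abs
    (f := fun x => x ^ q * rexp (-(2 * v : ℝ)⁻¹ * x ^ (2 : ℝ))),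
    integral_rpow_mul_exp_neg_mul_rpow two_pos hq hb,
    Real.inv_rpow (by positivity), neg_div, Real.rpow_neg (by positivity), inv_inv]
  ring

/-- Gaussian integration by parts for absolute moments. -/
lemma integral_abs_rpow_gaussianReal_eq_mul {v : ℝ≥0} (hv : v ≠ 0) {p : ℝ} (hp : 2 ≤ p) :
    ∫ x, |x| ^ p ∂(gaussianReal 0 v)
      = (p - 1) * v * ∫ x, |x| ^ (p - 2) ∂(gaussianReal 0 v) := by
  have hv' : (0 : ℝ) < v := by positivity
  rw [integral_abs_rpow_gaussianReal hv (by linarith),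
    integral_abs_rpow_gaussianReal hv (by linarith),
    show (p + 1) / 2 = (p - 2 + 1) / 2 + 1 by ring, Real.Gamma_add_one (by linarith),
    Real.rpow_add_one (by positivity)]
  ring

/-- The `L^p` norm of a centered Gaussian is at most `√((p - 1) v)`. -/
lemma eLpNorm_id_gaussianReal_sq_le {v : ℝ≥0} (hv : v ≠ 0) {p : ℝ} (hp : 2 ≤ p) :
    eLpNorm id (ENNReal.ofReal p) (gaussianReal 0 v) ^ 2 ≤ ENNReal.ofReal ((p - 1) * v) := by
  have hv' : (0 : ℝ) < v := by positivity
  have hnorm : ∀ q : ℝ, 0 < q → eLpNorm id (ENNReal.ofReal q) (gaussianReal 0 v)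
      = ENNReal.ofReal ((∫ x, |x| ^ q ∂(gaussianReal 0 v)) ^ q⁻¹) := by
    intro q hq
    have hmem : MemLp id (ENNReal.ofReal q) (gaussianReal 0 v) :=
      memLp_id_gaussianReal q.toNNReal
    rw [hmem.eLpNorm_eq_integral_rpow_norm (by simpa using hq) (by simp)]
    simp [hq.le]
  have hpos : ∀ q : ℝ, 0 ≤ q → 0 < ∫ x, |x| ^ q ∂(gaussianReal 0 v) := by
    intro q hq
    rw [integral_abs_rpow_gaussianReal hv (by linarith)]
    have := Real.Gamma_pos_of_pos (by linarith : 0 < (q + 1) / 2)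
    positivity
  set J := ∫ x, |x| ^ p ∂(gaussianReal 0 v) with hJ
  have hJpos : 0 < J := hpos p (by linarith)
  have hJ' : ∫ x, |x| ^ (p - 2) ∂(gaussianReal 0 v) ≤ J ^ ((p - 2) / p) := by
    rcases hp.eq_or_lt with rfl | hp2
    · simp
    · have h := eLpNorm_le_eLpNorm_of_exponent_le (μ := gaussianReal 0 v) (f := (id : ℝ → ℝ))
        (ENNReal.ofReal_le_ofReal (by linarith : p - 2 ≤ p)) aestronglyMeasurable_id
      rw [hnorm p (by linarith), hnorm (p - 2) (by linarith),
        ENNReal.ofReal_le_ofReal_iff (by positivity)] at h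
      have h' := Real.rpow_le_rpow (Real.rpow_nonneg (hpos _ (by linarith)).le _) h
        (by linarith : 0 ≤ p - 2)
      rwa [← Real.rpow_mul (hpos _ (by linarith)).le, inv_mul_cancel₀ (by linarith),
        Real.rpow_one, ← Real.rpow_mul hJpos.le, inv_mul_eq_div] at h'
  rw [hnorm p (by linarith), ← ENNReal.ofReal_pow (by positivity)]
  refine ENNReal.ofReal_le_ofReal ?_
  have hle : J ≤ (p - 1) * v * J ^ ((p - 2) / p) := by
    refine (integral_abs_rpow_gaussianReal_eq_mul hv hp).trans_le ?_
    exact mul_le_mul_of_nonneg_left hJ' (mul_nonneg (by linarith) hv'.le)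
  have hsplit : J = (J ^ p⁻¹) ^ 2 * J ^ ((p - 2) / p) := by
    rw [← Real.rpow_mul_natCast hJpos.le, ← Real.rpow_add hJpos]
    conv_lhs => rw [← Real.rpow_one J]
    congr 1
    push_cast
    field_simp
    ring
  have hq : 0 < J ^ ((p - 2) / p) := Real.rpow_pos_of_pos hJpos _
  refine le_of_mul_le_mul_right ?_ hq
  rwa [← hsplit]

section Minkowski

variable {α : Type*} [MeasurableSpace α] {μ : Measure α}

lemma eLpNorm_sq_eq_lintegral {F : Type*} [NormedAddCommGroup F] {p : ℝ} (hp : 0 < p)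
    (f : α → F) :
    eLpNorm f (ENNReal.ofReal p) μ ^ 2 = (∫⁻ a, (‖f a‖ₑ ^ 2) ^ (p / 2) ∂μ) ^ (1 / (p / 2)) := by
  rw [eLpNorm_eq_lintegral_rpow_enorm_toReal (by simpa using hp) (by simp),
    ENNReal.toReal_ofReal hp.le, ← ENNReal.rpow_mul_natCast]
  simp_rw [← ENNReal.rpow_natCast_mul]
  congr 1
  · congr! 3
    push_cast; ring
  · push_cast; field_simp

/-- Minkowski's inequality with a constant summand, on a probability space. -/
lemma lintegral_Lp_const_add_le [IsProbabilityMeasure μ] {q : ℝ} (hq : 1 ≤ q) (c : ℝ≥0∞)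
    {g : α → ℝ≥0∞} (hg : AEMeasurable g μ) :
    (∫⁻ a, (c + g a) ^ q ∂μ) ^ (1 / q) ≤ c + (∫⁻ a, g a ^ q ∂μ) ^ (1 / q) := by
  have h := ENNReal.lintegral_Lp_add_le (aemeasurable_const (b := c)) hg hq
  simp only [Pi.add_apply, lintegral_const, measure_univ, mul_one] at h
  rwa [one_div, ENNReal.rpow_rpow_inv (by linarith), ← one_div] at h

lemma lintegral_Lp_const_mul {q : ℝ} (hq : 0 < q) (c : ℝ≥0∞)
    {g : α → ℝ≥0∞} (hg : AEMeasurable g μ) :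
    (∫⁻ a, (c * g a) ^ q ∂μ) ^ (1 / q) = c * (∫⁻ a, g a ^ q ∂μ) ^ (1 / q) := by
  simp_rw [ENNReal.mul_rpow_of_nonneg _ _ hq.le]
  rw [lintegral_const_mul'' _ (hg.pow_const q), ENNReal.mul_rpow_of_nonneg _ _ (by positivity),
    one_div, ENNReal.rpow_rpow_inv hq.ne']

/-- Minkowski's inequality for finite sums. -/
lemma lintegral_Lp_finset_sum_le {ι : Type*} (s : Finset ι) {q : ℝ} (hq : 1 ≤ q)
    {g : ι → α → ℝ≥0∞} (hg : ∀ i ∈ s, AEMeasurable (g i) μ) :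
    (∫⁻ a, (∑ i ∈ s, g i a) ^ q ∂μ) ^ (1 / q) ≤ ∑ i ∈ s, (∫⁻ a, g i a ^ q ∂μ) ^ (1 / q) := by
  classical
  induction s using Finset.induction_on with
  | empty =>
    have hq0 : 0 < q := by linarith
    simp [ENNReal.zero_rpow_of_pos hq0, hq0]
  | insert i s his ih =>
    simp only [Finset.sum_insert his]
    have h := ENNReal.lintegral_Lp_add_le (hg i (by simp))
      (Finset.aemeasurable_fun_sum s fun j hj => hg j (by simp [hj])) hq
    simp only [Pi.add_apply] at h
    exact h.trans (add_le_add le_rfl (ih fun j hj => hg j (by simp [hj])))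

end Minkowski

section Gaussian

variable {E : Type*} [NormedAddCommGroup E] [InnerProductSpace ℝ E]

/-- Adding an independent scalar Gaussian multiple of `z` to `x` increases the squared `L^p` norm
by at most `(p - 1) ^ 2 * v * ‖z‖ ^ 2`. -/
lemma lintegral_enorm_add_smul_gaussianReal_le {v : ℝ≥0} (hv : v ≠ 0) {p : ℝ} (hp : 2 ≤ p)
    (x z : E) :
    (∫⁻ w, (‖x + w • z‖ₑ ^ 2) ^ (p / 2) ∂(gaussianReal 0 v)) ^ (1 / (p / 2))
      ≤ ‖x‖ₑ ^ 2 + ENNReal.ofReal ((p - 1) ^ 2 * v) * ‖z‖ₑ ^ 2 := by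
  set γ := gaussianReal 0 v with hγ
  have hq : 1 ≤ p / 2 := by linarith
  have hsq : ∀ y : E, (‖y‖ₑ ^ 2) ^ (p / 2) = ‖y‖ₑ ^ p := fun y => by
    rw [← ENNReal.rpow_natCast_mul]; congr 1; push_cast; ring
  have hmeas : ∀ c : ℝ, Measurable fun w : ℝ => ‖x + (c * w) • z‖ₑ ^ p := fun c =>
    (Continuous.measurable (by fun_prop)).pow_const _
  have hrefl : ∫⁻ w, ‖x - w • z‖ₑ ^ p ∂γ = ∫⁻ w, ‖x + w • z‖ₑ ^ p ∂γ := by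
    have hmap : γ.map (fun w => -w) = γ := by rw [hγ, gaussianReal_map_neg, neg_zero]
    conv_rhs => rw [← hmap]
    rw [lintegral_map (by simpa using hmeas 1) measurable_neg]
    simp [sub_eq_add_neg]
  have hsym : ∫⁻ w, ‖x + w • z‖ₑ ^ p ∂γ
      ≤ ∫⁻ w, (‖x‖ₑ ^ 2 + ENNReal.ofReal (p - 1) * ‖w • z‖ₑ ^ 2) ^ (p / 2) ∂γ := by
    refine (ENNReal.mul_le_mul_iff_right (a := 2) (by simp) (by simp)).1 ?_
    calc 2 * ∫⁻ w, ‖x + w • z‖ₑ ^ p ∂γ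
        = ∫⁻ w, (‖x + w • z‖ₑ ^ p + ‖x - w • z‖ₑ ^ p) ∂γ := by
          rw [lintegral_add_left (by simpa using hmeas 1), hrefl, two_mul]
      _ ≤ ∫⁻ w, 2 * (‖x‖ₑ ^ 2 + ENNReal.ofReal (p - 1) * ‖w • z‖ₑ ^ 2) ^ (p / 2) ∂γ :=
          lintegral_mono fun w => enorm_add_rpow_add_enorm_sub_rpow_le hp x (w • z)
      _ = _ := lintegral_const_mul' _ _ (by simp)
  simp_rw [hsq]
  calc (∫⁻ w, ‖x + w • z‖ₑ ^ p ∂γ) ^ (1 / (p / 2))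
      ≤ (∫⁻ w, (‖x‖ₑ ^ 2 + (ENNReal.ofReal (p - 1) * ‖z‖ₑ ^ 2) * ‖id w‖ₑ ^ 2) ^ (p / 2) ∂γ)
          ^ (1 / (p / 2)) := by
        refine ENNReal.rpow_le_rpow (hsym.trans_eq ?_) (by positivity)
        congr! 4 with w
        rw [enorm_smul, mul_pow, id]
        ring
    _ ≤ ‖x‖ₑ ^ 2 + ENNReal.ofReal (p - 1) * ‖z‖ₑ ^ 2
          * eLpNorm id (ENNReal.ofReal p) γ ^ 2 := by
        rw [eLpNorm_sq_eq_lintegral (by linarith),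
          ← lintegral_Lp_const_mul (by linarith) _ (by fun_prop)]
        exact lintegral_Lp_const_add_le hq _ (by fun_prop)
    _ ≤ ‖x‖ₑ ^ 2 + ENNReal.ofReal (p - 1) * ‖z‖ₑ ^ 2 * ENNReal.ofReal ((p - 1) * v) := by
        gcongr
        exact eLpNorm_id_gaussianReal_sq_le hv hp
    _ = _ := by
        rw [mul_right_comm, ← ENNReal.ofReal_mul (by linarith)]
        congr 3
        ring

/-- The multivariate form of `lintegral_enorm_add_smul_gaussianReal_le`. -/
lemma lintegral_enorm_add_sum_smul_pi_gaussianReal_le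
    {v : ℝ≥0} (hv : v ≠ 0) {p : ℝ} (hp : 2 ≤ p) {m : ℕ} (x : E) (z : Fin m → E) :
    (∫⁻ w, (‖x + ∑ i, w i • z i‖ₑ ^ 2) ^ (p / 2)
        ∂(Measure.pi fun _ : Fin m => gaussianReal 0 v)) ^ (1 / (p / 2))
      ≤ ‖x‖ₑ ^ 2 + ENNReal.ofReal ((p - 1) ^ 2 * v) * ∑ i, ‖z i‖ₑ ^ 2 := by
  have hq : 1 ≤ p / 2 := by linarith
  have hq0 : 0 < p / 2 := by linarith
  induction m generalizing x with
  | zero =>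
    simp only [Finset.univ_eq_empty, Finset.sum_empty, add_zero, lintegral_const, measure_univ,
      mul_one, mul_zero]
    rw [one_div, ENNReal.rpow_rpow_inv hq0.ne']
  | succ m ih =>
    have hmeas : Measurable fun a : ℝ × (Fin m → ℝ) =>
        (‖x + a.1 • z 0 + ∑ i, a.2 i • z i.succ‖ₑ ^ 2) ^ (p / 2) :=
      (Continuous.measurable (by fun_prop)).pow_const _
    have hsplit : ∫⁻ w, (‖x + ∑ i, w i • z i‖ₑ ^ 2) ^ (p / 2)
          ∂(Measure.pi fun _ : Fin (m + 1) => gaussianReal 0 v)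
        = ∫⁻ w, ∫⁻ w', (‖x + w • z 0 + ∑ i, w' i • z (Fin.succ i)‖ₑ ^ 2) ^ (p / 2)
          ∂(Measure.pi fun _ : Fin m => gaussianReal 0 v) ∂(gaussianReal 0 v) := by
      rw [← lintegral_prod _ hmeas.aemeasurable,
        ← (measurePreserving_piFinSuccAbove
          (fun _ : Fin (m + 1) => gaussianReal 0 v) 0).lintegral_comp hmeas]
      simp [Fin.sum_univ_succ, add_assoc, MeasurableEquiv.piFinSuccAbove, Fin.tail]
    have hinner : ∀ w : ℝ, ∫⁻ w', (‖x + w • z 0 + ∑ i, w' i • z (Fin.succ i)‖ₑ ^ 2) ^ (p / 2)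
          ∂(Measure.pi fun _ : Fin m => gaussianReal 0 v)
        ≤ (ENNReal.ofReal ((p - 1) ^ 2 * v) * ∑ i : Fin m, ‖z i.succ‖ₑ ^ 2
            + ‖x + w • z 0‖ₑ ^ 2) ^ (p / 2) := fun w => by
      rw [← ENNReal.rpow_inv_le_iff hq0, ← one_div, add_comm (_ * _)]
      exact ih (x + w • z 0) fun i => z i.succ
    rw [hsplit]
    calc _ ≤ _ := ENNReal.rpow_le_rpow (lintegral_mono hinner) (by positivity)
      _ ≤ _ := lintegral_Lp_const_add_le hq _ (Measurable.aemeasurable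
          (Continuous.measurable (by fun_prop)))
      _ ≤ _ := add_le_add le_rfl (lintegral_enorm_add_smul_gaussianReal_le hv hp x (z 0))
      _ = _ := by rw [Fin.sum_univ_succ]; ring

/-- A symmetric perturbation does not decrease the mean norm. -/
lemma enorm_le_lintegral_enorm_add_sum_smul_pi_gaussianReal
    {v : ℝ≥0} {m : ℕ} (x : E) (z : Fin m → E) :
    ‖x‖ₑ ≤ ∫⁻ w, ‖x + ∑ i, w i • z i‖ₑ ∂(Measure.pi fun _ : Fin m => gaussianReal 0 v) := by
  set γ := Measure.pi fun _ : Fin m => gaussianReal 0 v with hγ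
  have hmeas : Measurable fun w : Fin m → ℝ => ‖x + ∑ i, w i • z i‖ₑ :=
    Continuous.measurable (by fun_prop)
  have hmap : MeasurePreserving (fun (w : Fin m → ℝ) i => -w i) γ γ :=
    measurePreserving_pi _ _ fun _ =>
      ⟨measurable_neg, by rw [gaussianReal_map_neg, neg_zero]⟩
  refine (ENNReal.mul_le_mul_iff_right (a := 2) (by simp) (by simp)).1 ?_
  calc 2 * ‖x‖ₑ = ∫⁻ _, 2 * ‖x‖ₑ ∂γ := by simp
    _ ≤ ∫⁻ w, (‖x + ∑ i, w i • z i‖ₑ + ‖x + ∑ i, -w i • z i‖ₑ) ∂γ := by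
        refine lintegral_mono fun w => ?_
        have h := enorm_add_le (x + ∑ i, w i • z i) (x + ∑ i, -w i • z i)
        simp only [neg_smul, Finset.sum_neg_distrib] at h ⊢
        rw [add_add_add_comm, add_neg_cancel, add_zero, ← two_smul ℝ x, enorm_smul] at h
        simpa [show ‖(2 : ℝ)‖ₑ = 2 by rw [Real.enorm_eq_ofReal zero_le_two]; simp] using h
    _ = _ := by
        rw [lintegral_add_left hmeas, hmap.lintegral_comp hmeas, two_mul]

end Gaussian

/-- **Doob's `L^p` maximal inequality** for a nonnegative submartingale. -/
lemma MeasureTheory.Submartingale.mul_eLpNorm_sup'_le {Ω : Type*} {mΩ : MeasurableSpace Ω}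
    {μ : Measure Ω} [IsFiniteMeasure μ] {𝒢 : Filtration ℕ mΩ} {f : ℕ → Ω → ℝ}
    (hf : Submartingale f 𝒢 μ) (hnonneg : 0 ≤ f) {p : ℝ} (hp : 1 < p) (n : ℕ)
    (hLp : ∀ j ≤ n, MemLp (f j) (ENNReal.ofReal p) μ) :
    ENNReal.ofReal (p - 1) * eLpNorm (fun ω => (Finset.range (n + 1)).sup'
        Finset.nonempty_range_add_one fun j => f j ω) (ENNReal.ofReal p) μ
      ≤ ENNReal.ofReal p * eLpNorm (f n) (ENNReal.ofReal p) μ := by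
  set S : Ω → ℝ := fun ω => (Finset.range (n + 1)).sup'
    Finset.nonempty_range_add_one fun j => f j ω with hS
  have hp0 : 0 < p := by linarith
  have hp1 : 0 < p - 1 := by linarith
  have hfmeas : ∀ j, Measurable (f j) := fun j =>
    ((hf.stronglyAdapted j).mono (𝒢.le j)).measurable
  have hSmeas : Measurable S :=
    Finset.measurable_range_sup'' fun j _ => hfmeas j
  have hSnonneg : ∀ ω, 0 ≤ S ω := fun ω =>
    (hnonneg n ω).trans (Finset.le_sup' (fun j => f j ω) (Finset.self_mem_range_succ n))
  have hSLp : MemLp S (ENNReal.ofReal p) μ := by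
    refine (memLp_finsetSum (Finset.range (n + 1)) (f := f) fun j hj => hLp j ?_).mono'
      hSmeas.aestronglyMeasurable (Filter.Eventually.of_forall fun ω => ?_)
    · simpa [Nat.lt_succ_iff] using hj
    · rw [Real.norm_of_nonneg (hSnonneg ω)]
      refine Finset.sup'_le _ _ fun j hj => ?_
      exact Finset.single_le_sum (f := fun j => f j ω) (fun i _ => hnonneg i ω) hj
  set X : Ω → ℝ≥0∞ := fun ω => ENNReal.ofReal (f n ω) with hX
  have hXmeas : Measurable X := (hfmeas n).ennreal_ofReal
  set I := ∫⁻ ω, ENNReal.ofReal (S ω ^ p) ∂μ with hI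
  have hnormS : eLpNorm S (ENNReal.ofReal p) μ = I ^ (1 / p) := by
    rw [eLpNorm_eq_lintegral_rpow_enorm_toReal (by simpa using hp0) (by simp),
      ENNReal.toReal_ofReal hp0.le]
    congr! 3 with ω
    rw [Real.enorm_eq_ofReal (hSnonneg ω), ENNReal.ofReal_rpow_of_nonneg (hSnonneg ω) hp0.le]
  have hnormX : eLpNorm (f n) (ENNReal.ofReal p) μ = (∫⁻ ω, X ω ^ p ∂μ) ^ (1 / p) := by
    rw [eLpNorm_eq_lintegral_rpow_enorm_toReal (by simpa using hp0) (by simp),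
      ENNReal.toReal_ofReal hp0.le]
    congr! 3 with ω
    rw [Real.enorm_eq_ofReal (hnonneg n ω)]
  have hItop : I ≠ ∞ := by
    intro h
    have := hSLp.eLpNorm_lt_top
    rw [hnormS, h, ENNReal.top_rpow_of_pos (by positivity)] at this
    exact lt_irrefl _ this
  -- the layer-cake formulas for `μ` and for `μ.withDensity X`, compared by the weak inequality
  have hcake : ENNReal.ofReal (p - 1) * I
      ≤ ENNReal.ofReal p * ∫⁻ ω, X ω * ENNReal.ofReal (S ω ^ (p - 1)) ∂μ := by
    have h2 := lintegral_rpow_eq_lintegral_meas_le_mul (μ.withDensity X)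
      (Filter.Eventually.of_forall hSnonneg) hSmeas.aemeasurable hp1
    rw [lintegral_withDensity_eq_lintegral_mul _ hXmeas (by fun_prop)] at h2
    simp only [Pi.mul_apply] at h2
    rw [hI, lintegral_rpow_eq_lintegral_meas_le_mul μ (Filter.Eventually.of_forall hSnonneg)
      hSmeas.aemeasurable hp0, h2, mul_left_comm]
    gcongr ENNReal.ofReal p * (ENNReal.ofReal (p - 1) * ?_)
    refine setLIntegral_mono' measurableSet_Ioi fun t ht => ?_
    have ht0 : 0 < t := ht
    have hset : MeasurableSet {a | t ≤ S a} := measurableSet_le measurable_const hSmeas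
    have hmax := maximal_ineq hf hnonneg (ε := t.toNNReal) n
    rw [Real.coe_toNNReal t ht0.le, ofReal_integral_eq_lintegral_ofReal
      (hf.integrable n).integrableOn (Filter.Eventually.of_forall (hnonneg n))] at hmax
    rw [withDensity_apply _ hset, show p - 1 = 1 + (p - 1 - 1) by ring, Real.rpow_add ht0,
      Real.rpow_one, ENNReal.ofReal_mul ht0.le, ← mul_assoc, mul_comm (μ _)]
    rw [show 1 + (p - 1 - 1) - 1 = p - 1 - 1 by ring]
    gcongr
    exact hmax
  have hholder : ∫⁻ ω, X ω * ENNReal.ofReal (S ω ^ (p - 1)) ∂μ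
      ≤ (∫⁻ ω, X ω ^ p ∂μ) ^ (1 / p) * I ^ (1 - 1 / p) := by
    have hconj : p.HolderConjugate (p / (p - 1)) := Real.HolderConjugate.conjExponent hp
    have h := ENNReal.lintegral_mul_le_Lp_mul_Lq μ hconj hXmeas.aemeasurable
      (g := fun ω => ENNReal.ofReal (S ω ^ (p - 1))) (by fun_prop)
    refine h.trans_eq ?_
    congr 2
    · rw [hI]
      congr! 2 with ω
      rw [ENNReal.ofReal_rpow_of_nonneg (Real.rpow_nonneg (hSnonneg ω) _) (by positivity),
        ← Real.rpow_mul (hSnonneg ω)]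
      congr 2
      field_simp
    · field_simp
  rw [hnormS, hnormX]
  rcases eq_or_ne I 0 with h0 | h0
  · rw [h0, ENNReal.zero_rpow_of_pos (by positivity)]
    simp
  · have hpow0 : I ^ (1 - 1 / p) ≠ 0 := by
      simp [ENNReal.rpow_eq_zero_iff, h0, hItop]
    have hpowtop : I ^ (1 - 1 / p) ≠ ∞ := by
      simp [ENNReal.rpow_eq_top_iff, h0, hItop]
    refine (ENNReal.mul_le_mul_iff_left hpow0 hpowtop).1 ?_
    rw [mul_assoc, ← ENNReal.rpow_add _ _ h0 hItop, add_sub_cancel, ENNReal.rpow_one, mul_assoc]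
    exact hcake.trans (by gcongr)

/-- Integration of a function of a `𝒜`-measurable variable and a variable independent of `𝒜`,
over an `𝒜`-measurable set. -/
lemma setLIntegral_comp_of_indep {Ω β δ : Type*} {𝒜 mΩ : MeasurableSpace Ω} [MeasurableSpace β]
    [MeasurableSpace δ] {P : Measure Ω} [IsProbabilityMeasure P]
    (h𝒜 : 𝒜 ≤ mΩ) {V : Ω → β} {W : Ω → δ} (hV : Measurable[𝒜] V) (hW : Measurable W)
    (hind : Indep (MeasurableSpace.comap W inferInstance) 𝒜 P) {A : Set Ω}
    (hA : MeasurableSet[𝒜] A) {f : β × δ → ℝ≥0∞} (hf : Measurable f) :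
    ∫⁻ ω in A, f (V ω, W ω) ∂P = ∫⁻ ω in A, ∫⁻ w, f (V ω, w) ∂(P.map W) ∂P := by
  set U : Ω → ℝ≥0∞ × β := fun ω => (A.indicator 1 ω, V ω) with hU
  have hU𝒜 : Measurable[𝒜] U := (Measurable.indicator (f := 1) measurable_const hA).prodMk hV
  have hUm : Measurable U := hU𝒜.mono h𝒜 le_rfl
  have : IsProbabilityMeasure (P.map W) := Measure.isProbabilityMeasure_map hW.aemeasurable
  have hlaw : P.map (fun ω => (U ω, W ω)) = (P.map U).prod (P.map W) :=
    (indepFun_iff_map_prod_eq_prod_map_map hUm.aemeasurable hW.aemeasurable).1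
      (indep_of_indep_of_le_left hind.symm hU𝒜.comap_le)
  have hg : Measurable fun a : (ℝ≥0∞ × β) × δ => a.1.1 * f (a.1.2, a.2) := by fun_prop
  have hAm : MeasurableSet A := h𝒜 _ hA
  have hmul : ∀ g : Ω → ℝ≥0∞, ∫⁻ ω in A, g ω ∂P = ∫⁻ ω, A.indicator 1 ω * g ω ∂P := fun g => by
    rw [← lintegral_indicator hAm]
    refine lintegral_congr fun ω => ?_
    by_cases hω : ω ∈ A <;> simp [hω]
  calc ∫⁻ ω in A, f (V ω, W ω) ∂P
      = ∫⁻ a, a.1.1 * f (a.1.2, a.2) ∂(P.map fun ω => (U ω, W ω)) := by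
        rw [lintegral_map hg (hUm.prodMk hW), hmul]
    _ = ∫⁻ u, ∫⁻ w, u.1 * f (u.2, w) ∂(P.map W) ∂(P.map U) := by
        rw [hlaw, lintegral_prod _ hg.aemeasurable]
    _ = ∫⁻ ω, ∫⁻ w, (U ω).1 * f ((U ω).2, w) ∂(P.map W) ∂P :=
        lintegral_map hg.lintegral_prod_right' hUm
    _ = _ := by
        rw [hmul]
        refine lintegral_congr fun ω => ?_
        exact lintegral_const_mul _ (by fun_prop)

section GaussianTransform

variable {Ω E : Type*} {𝒜 mΩ : MeasurableSpace Ω} {P : Measure Ω} [IsProbabilityMeasure P]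
  [NormedAddCommGroup E] [InnerProductSpace ℝ E] [MeasurableSpace E] [BorelSpace E]
  [SecondCountableTopology E] {m : ℕ}

/-- One step of a Gaussian martingale transform, in `L^p`. -/
lemma eLpNorm_add_sum_smul_sq_le (h𝒜 : 𝒜 ≤ mΩ) {v : ℝ≥0} (hv : v ≠ 0)
    {p : ℝ} (hp : 2 ≤ p) {X : Ω → E} {z : Fin m → Ω → E} {W : Ω → Fin m → ℝ}
    (hX : Measurable[𝒜] X) (hz : ∀ i, Measurable[𝒜] (z i)) (hW : Measurable W)
    (hind : Indep (MeasurableSpace.comap W inferInstance) 𝒜 P)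
    (hlaw : P.map W = Measure.pi fun _ => gaussianReal 0 v) :
    eLpNorm (fun ω => X ω + ∑ i, W ω i • z i ω) (ENNReal.ofReal p) P ^ 2
      ≤ eLpNorm X (ENNReal.ofReal p) P ^ 2 + ENNReal.ofReal ((p - 1) ^ 2 * v)
        * ∑ i, eLpNorm (z i) (ENNReal.ofReal p) P ^ 2 := by
  have hq : 1 ≤ p / 2 := by linarith
  have hq0 : 0 < p / 2 := by linarith
  have hp0 : 0 < p := by linarith
  have hV : Measurable[𝒜] fun ω => (X ω, fun i => z i ω) :=
    hX.prodMk (@measurable_pi_lambda _ _ _ 𝒜 _ _ hz)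
  have hf : Measurable fun a : (E × (Fin m → E)) × (Fin m → ℝ) =>
      (‖a.1.1 + ∑ i, a.2 i • a.1.2 i‖ₑ ^ 2) ^ (p / 2) :=
    (Continuous.measurable (by fun_prop)).pow_const _
  have hXm : Measurable X := hX.mono h𝒜 le_rfl
  have hzm : ∀ i, Measurable (z i) := fun i => (hz i).mono h𝒜 le_rfl
  have hfub := setLIntegral_comp_of_indep h𝒜 hV hW hind MeasurableSet.univ hf
  simp only [Measure.restrict_univ, hlaw] at hfub
  set C := ENNReal.ofReal ((p - 1) ^ 2 * v)
  simp_rw [eLpNorm_sq_eq_lintegral hp0]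
  rw [hfub]
  calc _ ≤ (∫⁻ ω, (‖X ω‖ₑ ^ 2 + C * ∑ i, ‖z i ω‖ₑ ^ 2) ^ (p / 2) ∂P) ^ (1 / (p / 2)) := by
        refine ENNReal.rpow_le_rpow (lintegral_mono fun ω => ?_) (by positivity)
        rw [← ENNReal.rpow_inv_le_iff hq0, ← one_div]
        exact lintegral_enorm_add_sum_smul_pi_gaussianReal_le hv hp (X ω) fun i => z i ω
    _ ≤ _ := ENNReal.lintegral_Lp_add_le (f := fun ω => ‖X ω‖ₑ ^ 2)
        (g := fun ω => C * ∑ i, ‖z i ω‖ₑ ^ 2) (by fun_prop) (by fun_prop) hq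
    _ ≤ _ := by
        rw [lintegral_Lp_const_mul hq0 _ (by fun_prop)]
        gcongr
        exact lintegral_Lp_finset_sum_le _ hq fun i _ => by fun_prop

/-- One step of a Gaussian martingale transform does not decrease the mean norm on sets of the
past. -/
lemma setLIntegral_enorm_le_add_sum_smul (h𝒜 : 𝒜 ≤ mΩ) {v : ℝ≥0}
    {X : Ω → E} {z : Fin m → Ω → E} {W : Ω → Fin m → ℝ}
    (hX : Measurable[𝒜] X) (hz : ∀ i, Measurable[𝒜] (z i)) (hW : Measurable W)
    (hind : Indep (MeasurableSpace.comap W inferInstance) 𝒜 P)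
    (hlaw : P.map W = Measure.pi fun _ => gaussianReal 0 v) {A : Set Ω}
    (hA : MeasurableSet[𝒜] A) :
    ∫⁻ ω in A, ‖X ω‖ₑ ∂P ≤ ∫⁻ ω in A, ‖X ω + ∑ i, W ω i • z i ω‖ₑ ∂P := by
  have hV : Measurable[𝒜] fun ω => (X ω, fun i => z i ω) :=
    hX.prodMk (@measurable_pi_lambda _ _ _ 𝒜 _ _ hz)
  have hf : Measurable fun a : (E × (Fin m → E)) × (Fin m → ℝ) =>
      ‖a.1.1 + ∑ i, a.2 i • a.1.2 i‖ₑ := Continuous.measurable (by fun_prop)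
  rw [setLIntegral_comp_of_indep h𝒜 hV hW hind hA hf, hlaw]
  exact lintegral_mono fun ω =>
    enorm_le_lintegral_enorm_add_sum_smul_pi_gaussianReal (X ω) fun i => z i ω

/-- The Burkholder–Davis–Gundy inequality for Gaussian martingale transforms. -/
theorem eLpNorm_sup'_gaussian_transform_le (𝒢 : Filtration ℕ mΩ) {v : ℝ≥0} (hv : v ≠ 0)
    {p : ℝ} (hp : 2 ≤ p) {z : ℕ → Fin m → Ω → E} {W : ℕ → Ω → Fin m → ℝ} (n : ℕ)
    (hz : ∀ l < n, ∀ i, Measurable[𝒢 l] (z l i))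
    (hzLp : ∀ l < n, ∀ i, eLpNorm (z l i) (ENNReal.ofReal p) P < ∞)
    (hW : ∀ l < n, Measurable[𝒢 (l + 1)] (W l))
    (hind : ∀ l < n, Indep (MeasurableSpace.comap (W l) inferInstance) (𝒢 l) P)
    (hlaw : ∀ l < n, P.map (W l) = Measure.pi fun _ => gaussianReal 0 v) :
    eLpNorm (fun ω => (Finset.range (n + 1)).sup' Finset.nonempty_range_add_one
        fun j => ‖∑ l ∈ Finset.range j, ∑ i, W l ω i • z l i ω‖) (ENNReal.ofReal p) P
      ≤ ENNReal.ofReal p * (∑ l ∈ Finset.range n, ∑ i,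
          eLpNorm (z l i) (ENNReal.ofReal p) P ^ 2 * v) ^ ((1 : ℝ) / 2) := by
  set M : ℕ → Ω → E := fun j ω => ∑ l ∈ Finset.range j, ∑ i, W l ω i • z l i ω with hM
  have hMsucc : ∀ j, M (j + 1) = fun ω => M j ω + ∑ i, W j ω i • z j i ω := fun j => by
    funext ω
    simp [hM, Finset.sum_range_succ]
  have hMmeas : ∀ j ≤ n, Measurable[𝒢 j] (M j) := fun j hj => by
    refine Finset.measurable_fun_sum _ fun l hl => Finset.measurable_fun_sum _ fun i _ => ?_
    have hlj : l < j := Finset.mem_range.1 hl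
    have h1 : Measurable[𝒢 j] fun ω => W l ω i :=
      (measurable_pi_apply i).comp ((hW l (by omega)).mono (𝒢.mono (by omega)) le_rfl)
    exact h1.smul ((hz l (by omega) i).mono (𝒢.mono (by omega)) le_rfl)
  have hWm : ∀ l < n, Measurable (W l) := fun l hl => (hW l hl).mono (𝒢.le _) le_rfl
  set C := ENNReal.ofReal ((p - 1) ^ 2 * v) with hC
  have hbound : ∀ j ≤ n, eLpNorm (M j) (ENNReal.ofReal p) P ^ 2
      ≤ C * ∑ l ∈ Finset.range j, ∑ i, eLpNorm (z l i) (ENNReal.ofReal p) P ^ 2 := by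
    intro j
    induction j with
    | zero => intro _; simp [hM]
    | succ j ih =>
      intro hj
      rw [hMsucc, Finset.sum_range_succ, mul_add]
      exact (eLpNorm_add_sum_smul_sq_le (𝒢.le j) hv hp (hMmeas j (by omega)) (hz j hj)
        (hWm j hj) (hind j hj) (hlaw j hj)).trans (add_le_add (ih (by omega)) le_rfl)
  have hMLp : ∀ j ≤ n, MemLp (M j) (ENNReal.ofReal p) P := fun j hj => by
    refine ⟨((hMmeas j hj).mono (𝒢.le j) le_rfl).aestronglyMeasurable, ?_⟩
    refine lt_top_iff_ne_top.2 fun htop => ?_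
    have h := hbound j hj
    rw [htop, ENNReal.top_pow two_ne_zero, top_le_iff] at h
    refine ENNReal.mul_ne_top ENNReal.ofReal_ne_top (ENNReal.sum_ne_top.2 fun l hl =>
      ENNReal.sum_ne_top.2 fun i _ => ENNReal.pow_ne_top (hzLp l ?_ i).ne) h
    have := Finset.mem_range.1 hl
    omega
  have hp1 : (1 : ℝ≥0∞) ≤ ENNReal.ofReal p := by
    rw [← ENNReal.ofReal_one]
    exact ENNReal.ofReal_le_ofReal (by linarith)
  have hint : ∀ j ≤ n, Integrable (fun ω => ‖M j ω‖) P := fun j hj =>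
    ((hMLp j hj).integrable hp1).norm
  have hsub : Submartingale (fun j ω => ‖M (min j n) ω‖) 𝒢 P := by
    refine submartingale_of_setIntegral_le_succ (fun j => ?_)
      (fun j => hint _ (min_le_right _ _)) fun j A hA => ?_
    · exact measurable_norm.stronglyMeasurable.comp_measurable
        ((hMmeas _ (min_le_right j n)).mono (𝒢.mono (min_le_left j n)) le_rfl)
    · rcases lt_or_ge j n with hj | hj
      · rw [min_eq_left hj.le, min_eq_left (Nat.succ_le_of_lt hj)]
        rw [← ENNReal.ofReal_le_ofReal_iff (integral_nonneg fun _ => norm_nonneg _),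
          ofReal_integral_eq_lintegral_ofReal (hint j hj.le).integrableOn
            (Filter.Eventually.of_forall fun _ => norm_nonneg _),
          ofReal_integral_eq_lintegral_ofReal (hint (j + 1) hj).integrableOn
            (Filter.Eventually.of_forall fun _ => norm_nonneg _)]
        simp_rw [ofReal_norm]
        rw [hMsucc]
        exact setLIntegral_enorm_le_add_sum_smul (𝒢.le j) (hMmeas j hj.le) (hz j hj)
          (hWm j hj) (hind j hj) (hlaw j hj) hA
      · rw [min_eq_right hj, min_eq_right (by omega)]
  have hdoob := hsub.mul_eLpNorm_sup'_le (fun _ _ => norm_nonneg _) (by linarith : 1 < p) n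
    fun j hj => by simpa [min_eq_left hj] using (hMLp j hj).norm
  have hcongr : (fun ω => (Finset.range (n + 1)).sup' Finset.nonempty_range_add_one
      fun j => ‖M (min j n) ω‖) = fun ω => (Finset.range (n + 1)).sup'
      Finset.nonempty_range_add_one fun j => ‖M j ω‖ := by
    funext ω
    refine Finset.sup'_congr _ rfl fun j hj => ?_
    rw [min_eq_left (Nat.lt_succ_iff.1 (Finset.mem_range.1 hj))]
  rw [hcongr, min_self, eLpNorm_norm] at hdoob
  have hpm0 : ENNReal.ofReal (p - 1) ≠ 0 := by simp; linarith
  refine (ENNReal.mul_le_mul_iff_right hpm0 ENNReal.ofReal_ne_top).1 (hdoob.trans ?_)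
  rw [mul_left_comm]
  gcongr
  have hroot := ENNReal.rpow_le_rpow (hbound n le_rfl) (by norm_num : (0 : ℝ) ≤ 1 / 2)
  rw [← ENNReal.rpow_natCast_mul] at hroot
  norm_num at hroot
  refine hroot.trans_eq ?_
  rw [hC, ENNReal.ofReal_mul (sq_nonneg _), ENNReal.ofReal_pow (by linarith),
    ENNReal.ofReal_coe_nnreal, mul_assoc, ENNReal.mul_rpow_of_nonneg _ _ (by norm_num),
    ← ENNReal.rpow_natCast_mul]
  simp_rw [← Finset.sum_mul]
  norm_num
  rw [mul_comm (v : ℝ≥0∞)]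

end GaussianTransform

/-- Lemma 2.7: a discrete Burkholder-Davis-Gundy inequality. -/
theorem discrete_BDG
    (k m N : ℕ) (hk : 0 < k) (hm : 0 < m) (hN : 0 < N)
    (T p : ℝ) (hT : 0 < T) (hp : 2 ≤ p)
    (Ω : Type) (F : MeasurableSpace Ω) (P : Measure Ω) (hP : IsProbabilityMeasure P)
    (𝒢 : Fin (N + 1) → MeasurableSpace Ω)
    (h𝒢mono : Monotone 𝒢) (h𝒢le : ∀ i, 𝒢 i ≤ F)
    (Z : ℕ → Ω → Fin k → Fin m → ℝ)
    (ΔW : ℕ → Ω → Vec m)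
    (hZmeas : ∀ l (hl : l < N), Measurable[𝒢 ⟨l, by omega⟩] (Z l))
    (hZLp : ∀ l, l < N → ∀ i : Fin m,
      eLpNorm (fun ω => (WithLp.equiv 2 (Fin k → ℝ)).symm (fun r => Z l ω r i))
        (ENNReal.ofReal p) P < ⊤)
    (hWmeas : ∀ l (hl : l < N), Measurable[𝒢 ⟨l + 1, by omega⟩] (ΔW l))
    (hWindep : ∀ l (hl : l < N),
      Indep (MeasurableSpace.comap (ΔW l) inferInstance) (𝒢 ⟨l, by omega⟩) P)
    (hWlaw : ∀ l, l < N → Measure.map (ΔW l) P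
      = Measure.map (WithLp.toLp 2)
          (Measure.pi (fun _ : Fin m => gaussianReal 0 (Real.toNNReal (T / N)))))
    (n : ℕ) (hn : n ≤ N) :
    eLpNorm (fun ω => (Finset.range (n + 1)).sup' Finset.nonempty_range_add_one
        (fun j => ‖(WithLp.equiv 2 (Fin k → ℝ)).symm
          (fun r => ∑ l ∈ Finset.range j, ∑ i : Fin m, Z l ω r i * ΔW l ω i)‖))
        (ENNReal.ofReal p) P
      ≤ ENNReal.ofReal p * (∑ l ∈ Finset.range n, ∑ i : Fin m,
          (eLpNorm (fun ω => (WithLp.equiv 2 (Fin k → ℝ)).symm (fun r => Z l ω r i))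
              (ENNReal.ofReal p) P) ^ 2 * ENNReal.ofReal (T / N)) ^ ((1 : ℝ) / 2) := by
  have hTN : 0 < T / N := div_pos hT (by exact_mod_cast hN)
  have hv : Real.toNNReal (T / N) ≠ 0 := by simpa using hTN
  let ℱ : Filtration ℕ F :=
    { seq := fun j => 𝒢 ⟨min j N, by omega⟩
      mono' := fun i j hij => h𝒢mono (Fin.mk_le_mk.2 (min_le_min_right N hij))
      le' := fun j => h𝒢le _ }
  have hℱ : ∀ j (hj : j ≤ N), ℱ j = 𝒢 ⟨j, by omega⟩ := fun j hj => by
    change 𝒢 ⟨min j N, _⟩ = _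
    congr 2
    exact min_eq_left hj
  let z : ℕ → Fin m → Ω → Vec k := fun l i ω =>
    (WithLp.equiv 2 (Fin k → ℝ)).symm (fun r => Z l ω r i)
  let W : ℕ → Ω → Fin m → ℝ := fun l ω => WithLp.ofLp (ΔW l ω)
  have hofLp : Measurable (WithLp.ofLp : Vec m → Fin m → ℝ) := WithLp.measurable_ofLp 2 _
  have hmain := eLpNorm_sup'_gaussian_transform_le (P := P) ℱ hv hp (z := z) (W := W) n
    (fun l hl i => by
      rw [hℱ l (by omega)]
      have hZ := hZmeas l (by omega)
      refine (WithLp.measurable_toLp 2 (Fin k → ℝ)).comp ?_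
      refine @measurable_pi_lambda _ _ _ (𝒢 ⟨l, by omega⟩) _ _ fun r => ?_
      exact (measurable_pi_apply i).comp ((measurable_pi_apply r).comp hZ))
    (fun l hl i => hZLp l (by omega) i)
    (fun l hl => by
      rw [hℱ (l + 1) (by omega)]
      exact hofLp.comp (hWmeas l (by omega)))
    (fun l hl => by
      rw [hℱ l (by omega)]
      refine indep_of_indep_of_le_left (hWindep l (by omega)) ?_
      rw [show W l = WithLp.ofLp ∘ ΔW l from rfl, ← MeasurableSpace.comap_comp]
      exact MeasurableSpace.comap_mono hofLp.comap_le)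
    (fun l hl => by
      have hΔ : Measurable (ΔW l) := (hWmeas l (by omega)).mono (h𝒢le _) le_rfl
      rw [show W l = WithLp.ofLp ∘ ΔW l from rfl, ← Measure.map_map hofLp hΔ,
        hWlaw l (by omega), Measure.map_map hofLp (WithLp.measurable_toLp 2 _)]
      exact Measure.map_id)
  have hsum : ∀ j ω, (WithLp.equiv 2 (Fin k → ℝ)).symm
      (fun r => ∑ l ∈ Finset.range j, ∑ i : Fin m, Z l ω r i * ΔW l ω i)
      = ∑ l ∈ Finset.range j, ∑ i, W l ω i • z l i ω := fun j ω => by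
    ext r
    simp [z, W, mul_comm]
  simp_rw [hsum]
  exact hmain
end
end

section
/- Uniform moment bounds for the semi-tamed Milstein scheme (Theorem 2.1): under Assumption 2.1, for each p ≥ 1 there is a finite constant C (depending only on p, d, m, T, K, c, ϕ, φ, g and the law of ξ, but not on N) such that for every N ∈ ℕ and every probabilistic setup as below: sup_{0≤n≤N} E‖Y_n‖^p ≤ C. -/
open MeasureTheory ProbabilityTheory Real Finset
open scoped RealInnerProductSpace ENNReal NNReal

noncomputable section

/-- Second-order Bernoulli-type upper bound for powers. -/
theorem one_add_pow_le_quadratic (q : ℕ) {x : ℝ} (hx : -1 ≤ x) :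
    (1 + x) ^ q ≤ 1 + q * x + (q : ℝ) ^ 2 * x ^ 2 * (1 + |x|) ^ q := by
  induction q with
  | zero => simp
  | succ q ih =>
    have h1 : 0 ≤ 1 + x := by linarith
    have h2 : 1 + x ≤ 1 + |x| := by linarith [le_abs_self x]
    have h3 : (1 : ℝ) ≤ (1 + |x|) ^ (q + 1) := one_le_pow₀ (by linarith [abs_nonneg x])
    have h4 : (0 : ℝ) ≤ (q : ℝ) ^ 2 * x ^ 2 * (1 + |x|) ^ q := by positivity
    have h5 : (0 : ℝ) ≤ q * x ^ 2 := by positivity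
    have h6 : (0 : ℝ) ≤ ((q : ℝ) + 1) * x ^ 2 * (1 + |x|) ^ (q + 1) := by positivity
    calc (1 + x) ^ (q + 1) = (1 + x) * (1 + x) ^ q := by ring
      _ ≤ (1 + x) * (1 + q * x + (q : ℝ) ^ 2 * x ^ 2 * (1 + |x|) ^ q) := by gcongr
      _ = 1 + (q + 1) * x + q * x ^ 2 + (1 + x) * ((q : ℝ) ^ 2 * x ^ 2 * (1 + |x|) ^ q) := by ring
      _ ≤ 1 + (q + 1) * x + q * x ^ 2 * (1 + |x|) ^ (q + 1)
          + (1 + |x|) * ((q : ℝ) ^ 2 * x ^ 2 * (1 + |x|) ^ q) := by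
        have := le_mul_of_one_le_right h5 h3
        gcongr ?_ + ?_
        · linarith
        · exact mul_le_mul_of_nonneg_right h2 h4
      _ ≤ 1 + ((q + 1 : ℕ) : ℝ) * x
          + ((q + 1 : ℕ) : ℝ) ^ 2 * x ^ 2 * (1 + |x|) ^ (q + 1) := by
        push_cast
        linear_combination h6

/-- Expansion of a power of `κ + ‖z + u + v‖ ^ 2` around the drift part `z`, where `u` is the
first-order and `v` the second-order noise contribution at noise scale `s`. -/
theorem add_norm_sq_pow_le {E : Type*} [NormedAddCommGroup E] [InnerProductSpace ℝ E]
    {C T : ℝ} (hC : 0 ≤ C) (hT : 0 ≤ T) (q : ℕ) :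
    ∃ D : ℝ, 0 ≤ D ∧ ∀ (κ r s ρ : ℝ) (z u v : E), 0 ≤ κ → 0 < r → 0 ≤ s → s ^ 2 ≤ T → 1 ≤ ρ →
      κ + ‖z‖ ^ 2 ≤ (1 + C * s ^ 2) * r ^ 2 → ‖u‖ ≤ C * r * s * ρ → ‖v‖ ≤ C * r * s ^ 2 * ρ ^ 2 →
      (κ + ‖z + u + v‖ ^ 2) ^ q
        ≤ (r ^ 2) ^ q * (1 + q * (2 * ⟪z, u⟫ / r ^ 2) + D * s ^ 2 * ρ ^ (4 * q + 8)) := by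
  set B : ℝ := 1 + C * T with hB
  have hB0 : 1 ≤ B := by have := mul_nonneg hC hT; linarith
  set D₁ : ℝ := C + 2 * B * C + 2 * C ^ 2 + 2 * C ^ 2 * T with hD₁
  have hD₁0 : 0 ≤ D₁ := by positivity
  set D₂ : ℝ := 2 * B * C + D₁ * (1 + T) with hD₂
  have hD₂0 : 0 ≤ D₂ := by positivity
  refine ⟨q * D₁ + (q : ℝ) ^ 2 * D₂ ^ 2 * (1 + D₂ * (1 + T)) ^ q, by positivity, ?_⟩
  intro κ r s ρ z u v hκ hr hs hsT hρ hz hu hv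
  have hρ0 : 0 ≤ ρ := by linarith
  have hs1 : s ≤ 1 + T := by nlinarith
  have hρ12 : ρ ≤ ρ ^ 4 := le_self_pow₀ hρ (by norm_num)
  have hρ24 : ρ ^ 2 ≤ ρ ^ 4 := pow_le_pow_right₀ hρ (by norm_num)
  have hρ04 : 1 ≤ ρ ^ 4 := one_le_pow₀ hρ
  have hzB : ‖z‖ ≤ B * r := by
    refine le_of_sq_le_sq ?_ (by positivity)
    calc ‖z‖ ^ 2 ≤ (1 + C * s ^ 2) * r ^ 2 := by linarith
      _ ≤ (1 + C * T) * r ^ 2 := by gcongr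
      _ ≤ B * (B * r ^ 2) := by
        rw [← hB]; gcongr; exact le_mul_of_one_le_left (by positivity) hB0
      _ = (B * r) ^ 2 := by ring
  have hzu : |⟪z, u⟫| ≤ B * C * s * ρ * r ^ 2 :=
    calc |⟪z, u⟫| ≤ ‖z‖ * ‖u‖ := abs_real_inner_le_norm z u
      _ ≤ (B * r) * (C * r * s * ρ) := by gcongr
      _ = B * C * s * ρ * r ^ 2 := by ring
  have hzv : ⟪z, v⟫ ≤ B * C * s ^ 2 * ρ ^ 2 * r ^ 2 :=
    calc ⟪z, v⟫ ≤ ‖z‖ * ‖v‖ := real_inner_le_norm z v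
      _ ≤ (B * r) * (C * r * s ^ 2 * ρ ^ 2) := by gcongr
      _ = B * C * s ^ 2 * ρ ^ 2 * r ^ 2 := by ring
  have huv : ‖u + v‖ ^ 2 ≤ (2 * C ^ 2 * s ^ 2 * ρ ^ 2 + 2 * C ^ 2 * s ^ 2 * s ^ 2 * ρ ^ 4) * r ^ 2 :=
    calc ‖u + v‖ ^ 2 ≤ (C * r * s * ρ + C * r * s ^ 2 * ρ ^ 2) ^ 2 := by
          gcongr; exact (norm_add_le u v).trans (add_le_add hu hv)
      _ ≤ 2 * ((C * r * s * ρ) ^ 2 + (C * r * s ^ 2 * ρ ^ 2) ^ 2) := add_sq_le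
      _ = _ := by ring
  set l : ℝ := 2 * ⟪z, u⟫ / r ^ 2 with hl
  have hlr : l * r ^ 2 = 2 * ⟪z, u⟫ := by rw [hl]; field_simp
  set x : ℝ := l + D₁ * s ^ 2 * ρ ^ 4 with hx
  have hlabs : |l| ≤ 2 * B * C * s * ρ ^ 4 := by
    rw [hl, abs_div, abs_mul, abs_of_pos (by norm_num : (0 : ℝ) < 2),
      abs_of_pos (by positivity : 0 < r ^ 2), div_le_iff₀ (by positivity)]
    calc 2 * |⟪z, u⟫| ≤ 2 * (B * C * s * ρ * r ^ 2) := by gcongr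
      _ ≤ 2 * (B * C * s * ρ ^ 4 * r ^ 2) := by gcongr
      _ = _ := by ring
  have hexp : κ + ‖z + u + v‖ ^ 2 ≤ r ^ 2 * (1 + x) := by
    have e : ‖z + u + v‖ ^ 2 = ‖z‖ ^ 2 + 2 * ⟪z, u⟫ + 2 * ⟪z, v⟫ + ‖u + v‖ ^ 2 := by
      rw [add_assoc, norm_add_sq_real, inner_add_right]; ring
    have hθ : C * s ^ 2 + 2 * (B * C * s ^ 2 * ρ ^ 2)
        + (2 * C ^ 2 * s ^ 2 * ρ ^ 2 + 2 * C ^ 2 * s ^ 2 * s ^ 2 * ρ ^ 4)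
        ≤ D₁ * s ^ 2 * ρ ^ 4 :=
      calc _ ≤ C * s ^ 2 * ρ ^ 4 + 2 * (B * C * s ^ 2 * ρ ^ 4)
            + (2 * C ^ 2 * s ^ 2 * ρ ^ 4 + 2 * C ^ 2 * s ^ 2 * T * ρ ^ 4) := by
            gcongr ?_ + 2 * (B * C * s ^ 2 * ?_) +
              (2 * C ^ 2 * s ^ 2 * ?_ + 2 * C ^ 2 * s ^ 2 * ?_ * ρ ^ 4)
            exact le_mul_of_one_le_right (by positivity) hρ04
        _ = _ := by rw [hD₁]; ring
    have := mul_le_mul_of_nonneg_right hθ (sq_nonneg r)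
    rw [e, hx]
    nlinarith
  have hx1 : -1 ≤ x := by
    have h0 : 0 ≤ r ^ 2 * (1 + x) := le_trans (by positivity) hexp
    have := nonneg_of_mul_nonneg_right h0 (by positivity : 0 < r ^ 2)
    linarith
  have hxabs : |x| ≤ D₂ * s * ρ ^ 4 :=
    calc |x| ≤ |l| + |D₁ * s ^ 2 * ρ ^ 4| := abs_add_le _ _
      _ = |l| + D₁ * (s * s) * ρ ^ 4 := by
        rw [abs_of_nonneg (by positivity : 0 ≤ D₁ * s ^ 2 * ρ ^ 4)]; ring
      _ ≤ 2 * B * C * s * ρ ^ 4 + D₁ * ((1 + T) * s) * ρ ^ 4 := by gcongr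
      _ = _ := by rw [hD₂]; ring
  have hxsq : x ^ 2 ≤ D₂ ^ 2 * s ^ 2 * ρ ^ 8 :=
    calc x ^ 2 = |x| ^ 2 := (sq_abs x).symm
      _ ≤ (D₂ * s * ρ ^ 4) ^ 2 := by gcongr
      _ = _ := by ring
  have hx1q : (1 + |x|) ^ q ≤ (1 + D₂ * (1 + T)) ^ q * ρ ^ (4 * q) := by
    rw [pow_mul, ← mul_pow]
    gcongr
    calc 1 + |x| ≤ ρ ^ 4 + D₂ * (1 + T) * ρ ^ 4 := by
          gcongr
          exact hxabs.trans (by gcongr)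
      _ = _ := by ring
  calc (κ + ‖z + u + v‖ ^ 2) ^ q ≤ (r ^ 2 * (1 + x)) ^ q := by gcongr
    _ = (r ^ 2) ^ q * (1 + x) ^ q := mul_pow _ _ _
    _ ≤ (r ^ 2) ^ q * (1 + q * x + (q : ℝ) ^ 2 * x ^ 2 * (1 + |x|) ^ q) := by
      gcongr; exact one_add_pow_le_quadratic q hx1
    _ ≤ (r ^ 2) ^ q * (1 + q * (l + D₁ * s ^ 2 * ρ ^ (4 * q + 8))
        + (q : ℝ) ^ 2 * (D₂ ^ 2 * s ^ 2 * ρ ^ 8) * ((1 + D₂ * (1 + T)) ^ q * ρ ^ (4 * q))) := by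
      rw [hx]
      have : ρ ^ 4 ≤ ρ ^ (4 * q + 8) := pow_le_pow_right₀ hρ (by omega)
      gcongr
    _ = _ := by ring

/-- The Gaussian law of an increment is the scaled standard Gaussian law. -/
theorem map_toLp_pi_gaussianReal (m : ℕ) {h : ℝ} (hh : 0 ≤ h) :
    Measure.map (WithLp.toLp 2) (Measure.pi (fun _ : Fin m => gaussianReal 0 (Real.toNNReal h)))
      = Measure.map (fun v : Vec m => √h • v) (stdGaussian (Vec m)) := by
  have h1 : gaussianReal 0 (Real.toNNReal h) = (gaussianReal 0 1).map (√h * ·) := by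
    rw [gaussianReal_map_const_mul]
    congr 1
    · simp
    · ext; simp [hh]
  have h2 : Measure.pi (fun _ : Fin m => (gaussianReal 0 1).map (√h * ·))
      = (Measure.pi (fun _ : Fin m => gaussianReal 0 1)).map (fun x i => √h * x i) :=
    (Measure.pi_map_pi (fun _ => by fun_prop)).symm
  rw [h1, h2, ← map_pi_eq_stdGaussian, Measure.map_map (by fun_prop) (by fun_prop),
    Measure.map_map (by fun_prop) (by fun_prop)]
  rfl

theorem integrable_one_add_norm_pow_stdGaussian (m k : ℕ) :
    Integrable (fun v : Vec m => (1 + ‖v‖) ^ k) (stdGaussian (Vec m)) := by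
  have h0 : MemLp (fun v : Vec m => ‖v‖) k (stdGaussian (Vec m)) :=
    (IsGaussian.memLp_id (stdGaussian (Vec m)) k (ENNReal.natCast_ne_top k)).norm
  have h1 : MemLp (fun v : Vec m => 1 + ‖v‖) k (stdGaussian (Vec m)) :=
    MemLp.add (memLp_const (1 : ℝ)) h0
  refine h1.integrable_norm_pow'.congr (.of_forall fun v => ?_)
  simp only [Real.norm_of_nonneg (by positivity : (0 : ℝ) ≤ 1 + ‖v‖)]

/-- If `(X, U, V)` satisfies `X ⟂ (U, V)` and `U ⟂ V`, then `(X, U) ⟂ V`. -/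
theorem indepFun_prodMk_of_indepFun {Ω α β γ : Type*} [MeasurableSpace Ω] [MeasurableSpace α]
    [MeasurableSpace β] [MeasurableSpace γ] {P : Measure Ω} [IsProbabilityMeasure P]
    {X : Ω → α} {U : Ω → β} {V : Ω → γ} (hX : Measurable X) (hU : Measurable U)
    (hV : Measurable V) (h : IndepFun X (fun ω => (U ω, V ω)) P) (hUV : IndepFun U V P) :
    IndepFun (fun ω => (X ω, U ω)) V P := by
  have hXU : IndepFun X U P := h.comp measurable_id measurable_fst
  have := Measure.isProbabilityMeasure_map (μ := P) hX.aemeasurable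
  have := Measure.isProbabilityMeasure_map (μ := P) hU.aemeasurable
  have := Measure.isProbabilityMeasure_map (μ := P) hV.aemeasurable
  rw [indepFun_iff_map_prod_eq_prod_map_map (by fun_prop) (by fun_prop)] at h hUV hXU ⊢
  rw [hUV] at h
  rw [hXU, ← (MeasurableEquiv.prodAssoc.map_measurableEquiv_injective).eq_iff,
    Measure.prodAssoc_prod, ← h, Measure.map_map (by fun_prop) (by fun_prop)]
  rfl

/-- The deterministic part of one step of the scheme. -/
def tamedDrift {d : ℕ} (h : ℝ) (ph ps : Vec d → Vec d) (y : Vec d) : Vec d :=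
  y + h • ph y + (h / (1 + ‖ps y‖ * h)) • ps y

/-- The quadratic noise contribution in one step of the scheme. -/
def milsteinCorrection {d m : ℕ} (h : ℝ) (g : Fin m → Vec d → Vec d) (y : Vec d) (w : Vec m) :
    Vec d :=
  (2⁻¹ : ℝ) • ∑ j₁, ∑ j₂, (w j₁ * w j₂ - (if j₁ = j₂ then h else 0)) • Lg g j₁ j₂ y

theorem milstep_eq {d m : ℕ} (h : ℝ) (ph ps : Vec d → Vec d) (g : Fin m → Vec d → Vec d)
    (y : Vec d) (w : Vec m) :
    milstep h ph ps g y w = tamedDrift h ph ps y + Gclm g y w + milsteinCorrection h g y w := rfl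

theorem norm_le_of_lipschitz {E F : Type*} [SeminormedAddCommGroup E] [SeminormedAddCommGroup F]
    {f : E → F} {K : ℝ} (hf : ∀ x y, ‖f x - f y‖ ≤ K * ‖x - y‖) (x : E) :
    ‖f x‖ ≤ K * ‖x‖ + ‖f 0‖ := by
  have h1 := hf x 0
  rw [sub_zero] at h1
  linarith [norm_le_norm_sub_add (f x) (f 0)]

theorem norm_Gclm_smul_le {d m : ℕ} {K : ℝ} (hK : 0 ≤ K) {g : Fin m → Vec d → Vec d}
    (hgLip : ∀ x y : Vec d, ‖Gclm g x - Gclm g y‖ ≤ K * ‖x - y‖) {r s : ℝ} (hs : 0 ≤ s)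
    (hr : 1 ≤ r) (y : Vec d) (hy : ‖y‖ ≤ r) (v : Vec m) :
    ‖Gclm g y (s • v)‖ ≤ (K + ‖Gclm g 0‖) * r * s * (1 + ‖v‖) := by
  have h1 := norm_le_of_lipschitz hgLip y
  calc ‖Gclm g y (s • v)‖ ≤ ‖Gclm g y‖ * ‖s • v‖ := (Gclm g y).le_opNorm _
    _ ≤ (K * ‖y‖ + ‖Gclm g 0‖) * (s * ‖v‖) := by
      rw [norm_smul, Real.norm_of_nonneg hs]; gcongr
    _ ≤ (K * r + ‖Gclm g 0‖ * r) * (s * (1 + ‖v‖)) := by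
      gcongr
      · exact le_mul_of_one_le_right (norm_nonneg _) hr
      · linarith
    _ = _ := by ring

theorem norm_milsteinCorrection_le {d m : ℕ} {K : ℝ} (hK : 0 ≤ K) {g : Fin m → Vec d → Vec d}
    (hLgLip : ∀ (j₁ j₂ : Fin m) (x y : Vec d), ‖Lg g j₁ j₂ x - Lg g j₁ j₂ y‖ ≤ K * ‖x - y‖)
    {r : ℝ} (s : ℝ) (hr : 1 ≤ r) (y : Vec d) (hy : ‖y‖ ≤ r) (v : Vec m) :
    ‖milsteinCorrection (s ^ 2) g y (s • v)‖
      ≤ (∑ j₁, ∑ j₂, (K + ‖Lg g j₁ j₂ 0‖)) * r * s ^ 2 * (1 + ‖v‖) ^ 2 := by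
  have hterm (i j : Fin m) :
      ‖((s • v) i * (s • v) j - (if i = j then s ^ 2 else 0)) • Lg g i j y‖
        ≤ (K + ‖Lg g i j 0‖) * (r * s ^ 2 * (1 + ‖v‖) ^ 2) := by
    have hi : |v i| ≤ ‖v‖ := PiLp.norm_apply_le v i
    have hj : |v j| ≤ ‖v‖ := PiLp.norm_apply_le v j
    have hij : |v i * v j| ≤ ‖v‖ ^ 2 := by
      rw [abs_mul, sq]; gcongr
    have hδ : |(if i = j then s ^ 2 else 0)| ≤ s ^ 2 := by
      split_ifs <;> simp [sq_nonneg]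
    have hcoef : |(s • v) i * (s • v) j - (if i = j then s ^ 2 else 0)|
        ≤ s ^ 2 * (1 + ‖v‖) ^ 2 :=
      calc _ ≤ |s ^ 2 * (v i * v j)| + |(if i = j then s ^ 2 else 0)| := by
            refine (abs_sub _ _).trans_eq ?_
            simp only [PiLp.smul_apply, smul_eq_mul]
            ring_nf
        _ ≤ s ^ 2 * ‖v‖ ^ 2 + s ^ 2 := by
            rw [abs_mul, abs_of_nonneg (sq_nonneg s)]; gcongr
        _ ≤ s ^ 2 * (1 + ‖v‖) ^ 2 := by
            have := mul_nonneg (sq_nonneg s) (norm_nonneg v)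
            linarith [this]
    have hL := norm_le_of_lipschitz (hLgLip i j) y
    rw [norm_smul, Real.norm_eq_abs]
    calc _ ≤ (s ^ 2 * (1 + ‖v‖) ^ 2) * (K * r + ‖Lg g i j 0‖ * r) := by
          gcongr
          refine hL.trans ?_
          gcongr
          exact le_mul_of_one_le_right (norm_nonneg _) hr
      _ = _ := by ring
  calc ‖milsteinCorrection (s ^ 2) g y (s • v)‖
      ≤ 2⁻¹ * ∑ i, ∑ j, (K + ‖Lg g i j 0‖) * (r * s ^ 2 * (1 + ‖v‖) ^ 2) := by
        rw [milsteinCorrection, norm_smul, Real.norm_of_nonneg (by norm_num : (0 : ℝ) ≤ 2⁻¹)]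
        gcongr
        exact (norm_sum_le _ _).trans (Finset.sum_le_sum fun i _ =>
          (norm_sum_le _ _).trans (Finset.sum_le_sum fun j _ => hterm i j))
    _ ≤ ∑ i, ∑ j, (K + ‖Lg g i j 0‖) * (r * s ^ 2 * (1 + ‖v‖) ^ 2) := by
        have : 0 ≤ ∑ i, ∑ j, (K + ‖Lg g i j 0‖) * (r * s ^ 2 * (1 + ‖v‖) ^ 2) := by positivity
        linarith
    _ = _ := by simp only [← Finset.sum_mul]; ring

/-- One-step estimate: the noise inflates the `q`-th power of `κ + ‖y‖ ^ 2` by a factor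
`1 + O(h)` as soon as the deterministic part of the step inflates `κ + ‖y‖ ^ 2` by such a
factor. -/
theorem lintegral_milstep_pow_le {d m : ℕ} {T K C₀ : ℝ} (hT : 0 ≤ T) (hK : 0 ≤ K) (hC₀ : 0 ≤ C₀)
    (ph ps : Vec d → Vec d) {g : Fin m → Vec d → Vec d}
    (hgLip : ∀ x y : Vec d, ‖Gclm g x - Gclm g y‖ ≤ K * ‖x - y‖)
    (hLgLip : ∀ (j₁ j₂ : Fin m) (x y : Vec d), ‖Lg g j₁ j₂ x - Lg g j₁ j₂ y‖ ≤ K * ‖x - y‖)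
    (q : ℕ) :
    ∃ D : ℝ, 0 ≤ D ∧ ∀ (h κ : ℝ) (y : Vec d), 0 ≤ h → h ≤ T → 1 ≤ κ →
      κ + ‖tamedDrift h ph ps y‖ ^ 2 ≤ (1 + C₀ * h) * (κ + ‖y‖ ^ 2) →
      ∫⁻ v, ENNReal.ofReal ((κ + ‖milstep h ph ps g y (√h • v)‖ ^ 2) ^ q) ∂(stdGaussian (Vec m))
        ≤ ENNReal.ofReal ((1 + D * h) * (κ + ‖y‖ ^ 2) ^ q) := by
  set C : ℝ := C₀ + (K + ‖Gclm g 0‖) + ∑ j₁, ∑ j₂, (K + ‖Lg g j₁ j₂ 0‖) with hC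
  have hsum : 0 ≤ ∑ j₁, ∑ j₂, (K + ‖Lg g j₁ j₂ 0‖) := by positivity
  have hG0 : 0 ≤ K + ‖Gclm g 0‖ := by positivity
  have hC0 : 0 ≤ C := by positivity
  obtain ⟨D, hD, hstep⟩ := add_norm_sq_pow_le (E := Vec d) hC0 hT q
  set I : ℝ := ∫ v, (1 + ‖v‖) ^ (4 * q + 8) ∂(stdGaussian (Vec m)) with hI
  have hI0 : 0 ≤ I := integral_nonneg fun v => by positivity
  refine ⟨D * I, by positivity, ?_⟩
  intro h κ y hh hhT hκ hdrift
  set s := √h with hs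
  have hs0 : 0 ≤ s := Real.sqrt_nonneg h
  have hsh : s ^ 2 = h := Real.sq_sqrt hh
  set r := √(κ + ‖y‖ ^ 2) with hr
  have hrsq : r ^ 2 = κ + ‖y‖ ^ 2 := Real.sq_sqrt (by positivity)
  have hr1 : 1 ≤ r := Real.one_le_sqrt.mpr (by linarith [sq_nonneg ‖y‖])
  have hyr : ‖y‖ ≤ r := Real.le_sqrt_of_sq_le (by linarith)
  set z := tamedDrift h ph ps y with hz
  let ℓ : Vec m →L[ℝ] ℝ := (innerSL ℝ z).comp (Gclm g y)
  have hℓ (v : Vec m) : ⟪z, Gclm g y (s • v)⟫ = s * ℓ v := by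
    simp [ℓ, inner_smul_right]
  set F : Vec m → ℝ := fun v => (r ^ 2) ^ q *
    (1 + q * (2 * (s * ℓ v) / r ^ 2) + D * h * (1 + ‖v‖) ^ (4 * q + 8)) with hF
  have hpt (v : Vec m) : (κ + ‖milstep h ph ps g y (s • v)‖ ^ 2) ^ q ≤ F v := by
    have h1 := hstep κ r s (1 + ‖v‖) z (Gclm g y (s • v)) (milsteinCorrection (s ^ 2) g y (s • v))
      (by linarith) (by linarith) hs0 (by rw [hsh]; exact hhT) (by linarith [norm_nonneg v])
      (by
        rw [hsh, hrsq]
        refine hdrift.trans ?_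
        gcongr
        linarith)
      ((norm_Gclm_smul_le hK hgLip hs0 hr1 y hyr v).trans (by gcongr; linarith))
      ((norm_milsteinCorrection_le hK hLgLip s hr1 y hyr v).trans (by gcongr; linarith))
    rw [hsh, hℓ] at h1
    rw [milstep_eq]
    exact h1
  have hFi₁ : Integrable (fun v : Vec m => ℓ v) (stdGaussian (Vec m)) :=
    ℓ.integrable_comp IsGaussian.integrable_id
  have hFi₂ := integrable_one_add_norm_pow_stdGaussian m (4 * q + 8)
  have hlin : Integrable (fun v : Vec m => 1 + q * (2 * (s * ℓ v) / r ^ 2))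
      (stdGaussian (Vec m)) :=
    (integrable_const _).add ((((hFi₁.const_mul s).const_mul 2).div_const _).const_mul _)
  have hFint : Integrable F (stdGaussian (Vec m)) :=
    (hlin.add (hFi₂.const_mul (D * h))).const_mul _
  have hℓ0 : ∫ v, ℓ v ∂(stdGaussian (Vec m)) = 0 := integral_strongDual_stdGaussian ℓ
  have hFval : ∫ v, F v ∂(stdGaussian (Vec m)) = (1 + D * I * h) * (κ + ‖y‖ ^ 2) ^ q := by
    rw [hF, integral_const_mul, integral_add hlin (hFi₂.const_mul (D * h)),
      integral_add (integrable_const _)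
        ((((hFi₁.const_mul s).const_mul 2).div_const _).const_mul _),
      integral_const_mul, integral_div, integral_const_mul, integral_const_mul, hℓ0,
      integral_const_mul, ← hI, hrsq]
    simp
    ring
  rw [← hFval, ofReal_integral_eq_lintegral_ofReal hFint
    (.of_forall fun v => le_trans (by positivity) (hpt v))]
  exact lintegral_mono fun v => ENNReal.ofReal_le_ofReal (hpt v)

/-- A function whose derivative grows at most polynomially grows at most polynomially. -/
theorem exists_norm_le_pow_of_norm_fderiv_le {E F : Type*} [NormedAddCommGroup E]
    [NormedSpace ℝ E] [NormedAddCommGroup F] [NormedSpace ℝ F] {f : E → F} {K c : ℝ}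
    (hK : 0 ≤ K) (hc : 0 ≤ c) (hf : Differentiable ℝ f)
    (hf' : ∀ x, ‖fderiv ℝ f x‖ ≤ K * ‖x‖ ^ c) :
    ∃ (C : ℝ) (M : ℕ), 0 ≤ C ∧ ∀ y, ‖f y‖ ≤ C * (1 + ‖y‖ ^ 2) ^ M := by
  refine ⟨K + ‖f 0‖, ⌈c⌉₊ + 1, by positivity, fun y => ?_⟩
  have hmv : ‖f y - f 0‖ ≤ K * ‖y‖ ^ c * ‖y - 0‖ :=
    (convex_closedBall (0 : E) ‖y‖).norm_image_sub_le_of_norm_fderiv_le (fun x _ => hf x)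
      (fun x hx => (hf' x).trans (by
        have : ‖x‖ ≤ ‖y‖ := by simpa using hx
        gcongr)) (by simp) (by simp)
  rw [sub_zero] at hmv
  have ha : 1 ≤ 1 + ‖y‖ ^ 2 := by linarith [sq_nonneg ‖y‖]
  have hya : ‖y‖ ≤ 1 + ‖y‖ ^ 2 := by nlinarith [sq_nonneg (‖y‖ - 1)]
  have hyc : ‖y‖ ^ c ≤ (1 + ‖y‖ ^ 2) ^ ⌈c⌉₊ :=
    calc ‖y‖ ^ c ≤ (1 + ‖y‖ ^ 2) ^ c := by gcongr
      _ ≤ (1 + ‖y‖ ^ 2) ^ ((⌈c⌉₊ : ℕ) : ℝ) := Real.rpow_le_rpow_of_exponent_le ha (Nat.le_ceil c)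
      _ = _ := Real.rpow_natCast _ _
  calc ‖f y‖ ≤ ‖f y - f 0‖ + ‖f 0‖ := norm_le_norm_sub_add _ _
    _ ≤ K * (1 + ‖y‖ ^ 2) ^ ⌈c⌉₊ * (1 + ‖y‖ ^ 2) + ‖f 0‖ * (1 + ‖y‖ ^ 2) ^ (⌈c⌉₊ + 1) := by
      refine add_le_add (hmv.trans (by gcongr)) ?_
      exact le_mul_of_one_le_right (norm_nonneg _) (one_le_pow₀ ha)
    _ = _ := by ring

/-- Growth of the squared norm under the deterministic part of one step. -/
theorem norm_tamedDrift_sq_le {d : ℕ} {T K h : ℝ} (hK : 0 ≤ K) (hh : 0 ≤ h) (hhT : h ≤ T)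
    {ph ps : Vec d → Vec d}
    (hOSL : ∀ x y : Vec d, ⟪x - y, (ph x + ps x) - (ph y + ps y)⟫ ≤ K * ‖x - y‖ ^ 2)
    (hphLip : ∀ x y : Vec d, ‖ph x - ph y‖ ≤ K * ‖x - y‖) (y : Vec d) :
    ‖tamedDrift h ph ps y‖ ^ 2 ≤ ‖y‖ ^ 2
      + (2 * (K + (‖ph 0‖ + ‖ps 0‖)) + 4 * T * (K + (‖ph 0‖ + ‖ps 0‖)) ^ 2) * h * (1 + ‖y‖ ^ 2)
      + 2 * (h / (1 + ‖ps y‖ * h) * ‖ps y‖) ^ 2 := by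
  set b : ℝ := ‖ph 0‖ + ‖ps 0‖ with hb
  set t : ℝ := h / (1 + ‖ps y‖ * h) with ht
  have hT : 0 ≤ T := hh.trans hhT
  have hb0 : 0 ≤ b := by positivity
  have ht0 : 0 ≤ t := by positivity
  have hth : t ≤ h := div_le_self hh (by have := mul_nonneg (norm_nonneg (ps y)) hh; linarith)
  have hn := norm_nonneg y
  have hph : ‖ph y‖ ≤ K * ‖y‖ + b :=
    (norm_le_of_lipschitz hphLip y).trans (by rw [hb]; linarith [norm_nonneg (ps 0)])
  have hlin : ‖y‖ * (K * ‖y‖ + b) ≤ (K + b) * (1 + ‖y‖ ^ 2) := by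
    nlinarith [sq_nonneg (‖y‖ - 1)]
  have hin₁ : ⟪y, ph y⟫ ≤ (K + b) * (1 + ‖y‖ ^ 2) :=
    (real_inner_le_norm _ _).trans ((by gcongr : _ ≤ ‖y‖ * (K * ‖y‖ + b)).trans hlin)
  have hin₂ : ⟪y, ph y + ps y⟫ ≤ (K + b) * (1 + ‖y‖ ^ 2) := by
    have h1 := hOSL y 0
    rw [sub_zero, inner_sub_right] at h1
    have h2 : ⟪y, ph 0 + ps 0⟫ ≤ ‖y‖ * b :=
      (real_inner_le_norm _ _).trans (by gcongr; exact norm_add_le _ _)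
    linarith
  have hinner : ⟪y, h • ph y + t • ps y⟫ ≤ h * ((K + b) * (1 + ‖y‖ ^ 2)) := by
    have e : ⟪y, h • ph y + t • ps y⟫ = t * ⟪y, ph y + ps y⟫ + (h - t) * ⟪y, ph y⟫ := by
      simp only [inner_add_right, inner_smul_right]; ring
    have h1 := mul_le_mul_of_nonneg_left hin₂ ht0
    have h2 := mul_le_mul_of_nonneg_left hin₁ (sub_nonneg.mpr hth)
    rw [e]; linarith
  have hsq : ‖ph y‖ ^ 2 ≤ 2 * (K + b) ^ 2 * (1 + ‖y‖ ^ 2) :=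
    calc ‖ph y‖ ^ 2 ≤ ((K + b) * (1 + ‖y‖)) ^ 2 := by
          gcongr; exact hph.trans (by nlinarith)
      _ = (K + b) ^ 2 * (1 + ‖y‖) ^ 2 := mul_pow _ _ _
      _ ≤ (K + b) ^ 2 * (2 * (1 + ‖y‖ ^ 2)) := by
          gcongr; nlinarith [sq_nonneg (‖y‖ - 1)]
      _ = _ := by ring
  have hsum : ‖h • ph y + t • ps y‖ ^ 2
      ≤ h * (4 * T * (K + b) ^ 2 * (1 + ‖y‖ ^ 2)) + 2 * (t * ‖ps y‖) ^ 2 :=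
    calc ‖h • ph y + t • ps y‖ ^ 2 ≤ (h * ‖ph y‖ + t * ‖ps y‖) ^ 2 := by
          gcongr
          refine (norm_add_le _ _).trans_eq ?_
          rw [norm_smul, norm_smul, Real.norm_of_nonneg hh, Real.norm_of_nonneg ht0]
      _ ≤ 2 * ((h * ‖ph y‖) ^ 2 + (t * ‖ps y‖) ^ 2) := add_sq_le
      _ = 2 * (h * (h * ‖ph y‖ ^ 2)) + 2 * (t * ‖ps y‖) ^ 2 := by ring
      _ ≤ 2 * (h * (T * (2 * (K + b) ^ 2 * (1 + ‖y‖ ^ 2)))) + 2 * (t * ‖ps y‖) ^ 2 := by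
          gcongr
      _ = _ := by ring
  rw [tamedDrift, ← ht, add_assoc, norm_add_sq_real]
  linarith

/-- A Lyapunov function for the scheme with `N` steps, sandwiched between powers of
`1 + ‖y‖ ^ 2` that do not depend on `N`. -/
theorem exists_lyapunov_milstep {d m : ℕ} {T K c : ℝ} (hT : 0 < T) (hK : 0 ≤ K) (hc : 0 ≤ c)
    {ph ps : Vec d → Vec d} {g : Fin m → Vec d → Vec d}
    (hOSL : ∀ x y : Vec d, ⟪x - y, (ph x + ps x) - (ph y + ps y)⟫ ≤ K * ‖x - y‖ ^ 2)
    (hgLip : ∀ x y : Vec d, ‖Gclm g x - Gclm g y‖ ≤ K * ‖x - y‖)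
    (hphLip : ∀ x y : Vec d, ‖ph x - ph y‖ ≤ K * ‖x - y‖)
    (hps : Differentiable ℝ ps) (hps' : ∀ x : Vec d, ‖fderiv ℝ ps x‖ ≤ K * ‖x‖ ^ c)
    (hLgLip : ∀ (j₁ j₂ : Fin m) (x y : Vec d), ‖Lg g j₁ j₂ x - Lg g j₁ j₂ y‖ ≤ K * ‖x - y‖)
    (q : ℕ) :
    ∃ (Q : ℕ) (D : ℝ), 0 ≤ D ∧ ∀ N : ℕ, 0 < N → ∃ V : Vec d → ℝ, Continuous V ∧
      (∀ y, (1 + ‖y‖ ^ 2) ^ q ≤ V y) ∧ (∀ y, V y ≤ (1 + ‖y‖ ^ 2) ^ Q) ∧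
      ∀ y, ∫⁻ v, ENNReal.ofReal (V (milstep (T / N) ph ps g y (√(T / N) • v)))
        ∂(stdGaussian (Vec m)) ≤ ENNReal.ofReal (1 + D * (T / N)) * ENNReal.ofReal (V y) := by
  obtain ⟨C₁, M, hC₁, hgrow⟩ := exists_norm_le_pow_of_norm_fderiv_le hK hc hps hps'
  set b : ℝ := ‖ph 0‖ + ‖ps 0‖ with hb
  set C₂ : ℝ := 2 * (K + b) + 4 * T * (K + b) ^ 2 with hC₂
  have hC₂0 : 0 ≤ C₂ := by positivity
  set C₀ : ℝ := C₂ + 2 * T * C₁ ^ 2 + 2 / T with hC₀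
  have hC₀0 : 0 ≤ C₀ := by positivity
  set Q : ℕ := q + 2 * M * q with hQ
  obtain ⟨D₁, hD₁, hstep₁⟩ := lintegral_milstep_pow_le hT.le hK hC₀0 ph ps hgLip hLgLip Q
  obtain ⟨D₂, hD₂, hstep₂⟩ := lintegral_milstep_pow_le hT.le hK hC₀0 ph ps hgLip hLgLip q
  refine ⟨Q, D₁ + D₂, by positivity, fun N hN => ?_⟩
  have hN1 : (1 : ℝ) ≤ N := by exact_mod_cast hN
  have hN0 : (0 : ℝ) < N := by linarith
  set h : ℝ := T / N with hh
  have hh0 : 0 ≤ h := by positivity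
  have hhT : h ≤ T := div_le_self hT.le hN1
  have hhN : h * N = T := by rw [hh]; field_simp
  have hone (y : Vec d) : 1 ≤ 1 + ‖y‖ ^ 2 := by linarith [sq_nonneg ‖y‖]
  have hdrift (y : Vec d) := norm_tamedDrift_sq_le hK hh0 hhT hOSL hphLip y
  refine ⟨fun y => min ((1 + ‖y‖ ^ 2) ^ Q) ((N + ‖y‖ ^ 2) ^ q), by fun_prop, fun y => ?_,
    fun y => min_le_left _ _, fun y => ?_⟩
  · refine le_min (pow_le_pow_right₀ (hone y) (by omega)) (by gcongr)
  have hlarge : ∫⁻ v, ENNReal.ofReal ((N + ‖milstep h ph ps g y (√h • v)‖ ^ 2) ^ q)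
      ∂(stdGaussian (Vec m)) ≤ ENNReal.ofReal ((1 + D₂ * h) * (N + ‖y‖ ^ 2) ^ q) := by
    refine hstep₂ h N y hh0 hhT hN1 ?_
    have h1 : h / (1 + ‖ps y‖ * h) * ‖ps y‖ ≤ 1 := by
      rw [div_mul_eq_mul_div, div_le_one (by positivity)]
      linarith
    have h2 : (h / (1 + ‖ps y‖ * h) * ‖ps y‖) ^ 2 ≤ 1 := pow_le_one₀ (by positivity) h1
    have h3 : C₂ * h * (1 + ‖y‖ ^ 2) ≤ C₂ * h * (N + ‖y‖ ^ 2) := by gcongr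
    have h4 : 2 = 2 / T * h * N := by rw [mul_assoc, hhN]; field_simp
    have h5 : 0 ≤ 2 / T * h * ‖y‖ ^ 2 := by positivity
    have h6 : 0 ≤ 2 * T * C₁ ^ 2 * h * (N + ‖y‖ ^ 2) := by positivity
    rw [hC₀]
    linarith [hdrift y]
  have hsmall (hy : (1 + ‖y‖ ^ 2) ^ (2 * M) ≤ N) :
      ∫⁻ v, ENNReal.ofReal ((1 + ‖milstep h ph ps g y (√h • v)‖ ^ 2) ^ Q)
      ∂(stdGaussian (Vec m)) ≤ ENNReal.ofReal ((1 + D₁ * h) * (1 + ‖y‖ ^ 2) ^ Q) := by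
    refine hstep₁ h 1 y hh0 hhT le_rfl ?_
    have h1 : (h / (1 + ‖ps y‖ * h) * ‖ps y‖) ^ 2 ≤ T * C₁ ^ 2 * h :=
      calc (h / (1 + ‖ps y‖ * h) * ‖ps y‖) ^ 2 ≤ (h * (C₁ * (1 + ‖y‖ ^ 2) ^ M)) ^ 2 := by
            gcongr
            · exact div_le_self hh0 (by have := mul_nonneg (norm_nonneg (ps y)) hh0; linarith)
            · exact hgrow y
        _ = C₁ ^ 2 * h * (h * (1 + ‖y‖ ^ 2) ^ (2 * M)) := by ring
        _ ≤ C₁ ^ 2 * h * (h * N) := by gcongr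
        _ = T * C₁ ^ 2 * h := by rw [hhN]; ring
    have h2 : 2 * T * C₁ ^ 2 * h ≤ 2 * T * C₁ ^ 2 * h * (1 + ‖y‖ ^ 2) :=
      le_mul_of_one_le_right (by positivity) (hone y)
    have h3 : 0 ≤ 2 / T * h * (1 + ‖y‖ ^ 2) := by positivity
    rw [hC₀]
    linarith [hdrift y]
  have hfac : 0 ≤ 1 + (D₁ + D₂) * h := by positivity
  rw [← ENNReal.ofReal_mul hfac]
  beta_reduce
  have hviaLarge : ∫⁻ v, ENNReal.ofReal (min ((1 + ‖milstep h ph ps g y (√h • v)‖ ^ 2) ^ Q)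
      ((N + ‖milstep h ph ps g y (√h • v)‖ ^ 2) ^ q)) ∂(stdGaussian (Vec m))
      ≤ ENNReal.ofReal ((1 + (D₁ + D₂) * h) * (N + ‖y‖ ^ 2) ^ q) :=
    (lintegral_mono fun v => ENNReal.ofReal_le_ofReal (min_le_right _ _)).trans
      (hlarge.trans (ENNReal.ofReal_le_ofReal (by gcongr; linarith)))
  rcases le_total ((N + ‖y‖ ^ 2) ^ q) ((1 + ‖y‖ ^ 2) ^ Q) with hle | hle
  · rw [min_eq_right hle]
    exact hviaLarge
  rw [min_eq_left hle]
  by_cases hy : (1 + ‖y‖ ^ 2) ^ (2 * M) ≤ N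
  · exact (lintegral_mono fun v => ENNReal.ofReal_le_ofReal (min_le_left _ _)).trans
      ((hsmall hy).trans (ENNReal.ofReal_le_ofReal (by gcongr; linarith)))
  · have hge : (N + ‖y‖ ^ 2) ^ q ≤ (1 + ‖y‖ ^ 2) ^ Q :=
      calc (N + ‖y‖ ^ 2) ^ q ≤ (N * (1 + ‖y‖ ^ 2)) ^ q := by
            gcongr
            nlinarith [sq_nonneg ‖y‖]
        _ ≤ ((1 + ‖y‖ ^ 2) ^ (2 * M) * (1 + ‖y‖ ^ 2)) ^ q := by
            gcongr
            exact (not_le.mp hy).le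
        _ = (1 + ‖y‖ ^ 2) ^ Q := by rw [hQ, mul_pow, ← pow_mul, ← pow_add]; congr 1; omega
    rw [← le_antisymm hge hle]
    exact hviaLarge

theorem continuous_milstep {d m : ℕ} (h : ℝ) {ph ps : Vec d → Vec d} {g : Fin m → Vec d → Vec d}
    (hph : Continuous ph) (hps : Continuous ps) (hg : ∀ j, Continuous (g j))
    (hLg : ∀ j₁ j₂, Continuous (Lg g j₁ j₂)) (hh : 0 ≤ h) :
    Continuous (fun x : Vec d × Vec m => milstep h ph ps g x.1 x.2) := by
  have hG : Continuous (fun x : Vec d × Vec m => Gclm g x.1 x.2) := by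
    change Continuous (fun x : Vec d × Vec m => ∑ j, x.2 j • g j x.1)
    fun_prop
  have hden (x : Vec d × Vec m) : 1 + ‖ps x.1‖ * h ≠ 0 := by positivity
  unfold milstep
  fun_prop (disch := exact hden)

/-- The scheme at time `n` is independent of the `n`-th increment. -/
theorem measurable_and_indepFun_of_recursion {Ω α β : Type*} [MeasurableSpace Ω]
    [MeasurableSpace α] [MeasurableSpace β] {P : Measure Ω} [IsProbabilityMeasure P]
    {ξ : Ω → α} {W : ℕ → Ω → β} {Y : ℕ → Ω → α} {f : α × β → α} (hf : Measurable f)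
    (hξ : Measurable ξ) (hW : ∀ k, Measurable (W k)) (hWind : iIndepFun W P)
    (hξW : IndepFun ξ (fun ω k => W k ω) P) (hY0 : ∀ ω, Y 0 ω = ξ ω)
    (hYs : ∀ n ω, Y (n + 1) ω = f (Y n ω, W n ω)) (n : ℕ) :
    Measurable (Y n) ∧ IndepFun (Y n) (W n) P := by
  have hrep : ∃ F : α × (Finset.range n → β) → α, Measurable F ∧
      ∀ ω, Y n ω = F (ξ ω, fun i => W i ω) := by
    induction n with
    | zero => exact ⟨Prod.fst, measurable_fst, hY0⟩
    | succ n ih =>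
      obtain ⟨F, hF, hYF⟩ := ih
      refine ⟨fun x => f (F (x.1, fun i => x.2 ⟨i, Finset.mem_range.mpr
        ((Finset.mem_range.mp i.2).trans n.lt_succ_self)⟩),
        x.2 ⟨n, Finset.self_mem_range_succ n⟩), by fun_prop, fun ω => ?_⟩
      rw [hYs, hYF]
  obtain ⟨F, hF, hYF⟩ := hrep
  have hU : Measurable (fun ω (i : Finset.range n) => W i ω) := by fun_prop
  have hYF' : Y n = F ∘ fun ω => (ξ ω, fun i : Finset.range n => W i ω) := funext hYF
  have hUW : IndepFun (fun ω (i : Finset.range n) => W i ω) (W n) P :=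
    (hWind.indepFun_finset (Finset.range n) {n} (by simp) hW).comp measurable_id
      (measurable_pi_apply (⟨n, Finset.mem_singleton_self n⟩ : ({n} : Finset ℕ)))
  have hξUW : IndepFun ξ (fun ω => ((fun i : Finset.range n => W i ω), W n ω)) P :=
    hξW.comp (φ := id) (ψ := fun w : ℕ → β => ((fun i : Finset.range n => w i), w n))
      measurable_id (by fun_prop)
  refine ⟨by rw [hYF']; fun_prop, ?_⟩
  rw [hYF']
  exact (indepFun_prodMk_of_indepFun hξ hU (hW n) hξUW hUW).comp hF measurable_id

/-- Theorem 2.1: uniform boundedness of the p-th moments of the semi-tamed Milstein scheme. -/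
theorem uniform_pth_moment_bounds_semi_tamed_Milstein
    (d m : ℕ) (hd : 0 < d) (hm : 0 < m)
    (T K c : ℝ) (hT : 0 < T) (hK : 1 ≤ K) (hc : 1 ≤ c)
    (ph ps : Vec d → Vec d) (g : Fin m → Vec d → Vec d)
    (hgdiff : ∀ j, ContDiff ℝ 1 (g j))
    (hOSL : ∀ x y : Vec d, ⟪x - y, (ph x + ps x) - (ph y + ps y)⟫ ≤ K * ‖x - y‖ ^ 2)
    (hgLip : ∀ x y : Vec d, ‖Gclm g x - Gclm g y‖ ≤ K * ‖x - y‖)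
    (hphLip : ∀ x y : Vec d, ‖ph x - ph y‖ ≤ K * ‖x - y‖)
    (hpsC : ContDiff ℝ 1 ps)
    (hps' : ∀ x : Vec d, ‖fderiv ℝ ps x‖ ≤ K * ‖x‖ ^ c)
    (hLgLip : ∀ (j₁ j₂ : Fin m) (x y : Vec d), ‖Lg g j₁ j₂ x - Lg g j₁ j₂ y‖ ≤ K * ‖x - y‖)
    (μξ : Measure (Vec d)) (hμξprob : IsProbabilityMeasure μξ)
    (hμξmom : ∀ r : ℕ, Integrable (fun x => ‖x‖ ^ r) μξ)
    (p : ℝ) (hp : 1 ≤ p) :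
    ∃ C : ℝ, ∀ (N : ℕ), 0 < N →
      ∀ (Ω : Type) (mΩ : MeasurableSpace Ω) (P : Measure Ω), IsProbabilityMeasure P →
      ∀ (ξ : Ω → Vec d) (ΔW : ℕ → Ω → Vec m) (Y : ℕ → Ω → Vec d),
        Measurable ξ → (∀ k, Measurable (ΔW k)) →
        Measure.map ξ P = μξ →
        (∀ k, Measure.map (ΔW k) P
            = Measure.map (WithLp.toLp 2)
                (Measure.pi (fun _ : Fin m => gaussianReal 0 (Real.toNNReal (T / N))))) →
        iIndepFun ΔW P →
        IndepFun ξ (fun ω k => ΔW k ω) P →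
        (∀ ω, Y 0 ω = ξ ω) →
        (∀ n ω, Y (n + 1) ω = milstep (T / N) ph ps g (Y n ω) (ΔW n ω)) →
        ∀ n ≤ N, ∫⁻ ω, ENNReal.ofReal (‖Y n ω‖ ^ p) ∂P ≤ ENNReal.ofReal C := by

  have hK0 : 0 ≤ K := by linarith
  obtain ⟨q, hq⟩ := exists_nat_ge p
  obtain ⟨Q, D, hD, hlyap⟩ := exists_lyapunov_milstep hT hK0 (by linarith) hOSL hgLip hphLip
    (hpsC.differentiable one_ne_zero) hps' hLgLip q
  have hmom : Integrable (fun x : Vec d => (1 + ‖x‖ ^ 2) ^ Q) μξ := by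
    refine (((integrable_const (1 : ℝ)).add (hμξmom (2 * Q))).const_mul (2 ^ (Q - 1))).mono'
      (by fun_prop) (.of_forall fun x => ?_)
    rw [Real.norm_of_nonneg (by positivity)]
    refine (add_pow_le zero_le_one (sq_nonneg ‖x‖) Q).trans_eq ?_
    simp [pow_mul]
  refine ⟨Real.exp (D * T) * ∫ x, (1 + ‖x‖ ^ 2) ^ Q ∂μξ, ?_⟩
  intro N hN Ω mΩ P hP ξ ΔW Y hξ hW hξlaw hWlaw hWind hξW hY0 hYs n hn
  obtain ⟨V, hVc, hVlow, hVup, hVstep⟩ := hlyap N hN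
  have hh : 0 ≤ T / (N : ℝ) := by positivity
  have hlip {f : Vec d → Vec d} (hf : ∀ x y, ‖f x - f y‖ ≤ K * ‖x - y‖) : Continuous f :=
    (LipschitzWith.of_dist_le' (K := K) fun x y => by
      simpa only [dist_eq_norm] using hf x y).continuous
  have hstepc := continuous_milstep (T / N) (hlip hphLip) hpsC.continuous
    (fun j => (hgdiff j).continuous) (fun j₁ j₂ => hlip (hLgLip j₁ j₂)) hh
  have hind (k : ℕ) := measurable_and_indepFun_of_recursion hstepc.measurable hξ hW hWind hξW hY0
    hYs k
  have hrec (k : ℕ) : ∫⁻ ω, ENNReal.ofReal (V (Y (k + 1) ω)) ∂P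
      ≤ ENNReal.ofReal (1 + D * (T / N)) * ∫⁻ ω, ENNReal.ofReal (V (Y k ω)) ∂P := by
    obtain ⟨hYm, hYind⟩ := hind k
    have hlaw := (indepFun_iff_map_prod_eq_prod_map_map hYm.aemeasurable
      (hW k).aemeasurable).mp hYind
    have := Measure.isProbabilityMeasure_map (μ := P) (hW k).aemeasurable
    have hVm : Measurable (fun x : Vec d × Vec m =>
        ENNReal.ofReal (V (milstep (T / N) ph ps g x.1 x.2))) :=
      ENNReal.measurable_ofReal.comp (hVc.comp hstepc).measurable
    calc ∫⁻ ω, ENNReal.ofReal (V (Y (k + 1) ω)) ∂P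
        = ∫⁻ x, ENNReal.ofReal (V (milstep (T / N) ph ps g x.1 x.2))
            ∂(P.map fun ω => (Y k ω, ΔW k ω)) := by
          rw [lintegral_map hVm (by fun_prop)]
          simp only [hYs]
      _ = ∫⁻ y, ∫⁻ v, ENNReal.ofReal (V (milstep (T / N) ph ps g y (√(T / N) • v)))
            ∂(stdGaussian (Vec m)) ∂(P.map (Y k)) := by
          rw [hlaw, lintegral_prod _ hVm.aemeasurable, hWlaw k, map_toLp_pi_gaussianReal m hh]
          refine lintegral_congr fun y => ?_
          exact lintegral_map (hVm.comp measurable_prodMk_left) (by fun_prop)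
      _ ≤ ∫⁻ y, ENNReal.ofReal (1 + D * (T / N)) * ENNReal.ofReal (V y) ∂(P.map (Y k)) :=
          lintegral_mono hVstep
      _ = _ := by
          have hVm' : Measurable (fun y => ENNReal.ofReal (V y)) :=
            ENNReal.measurable_ofReal.comp hVc.measurable
          rw [lintegral_const_mul _ hVm', lintegral_map hVm' hYm]
  have hiter (k : ℕ) : ∫⁻ ω, ENNReal.ofReal (V (Y k ω)) ∂P
      ≤ ENNReal.ofReal ((1 + D * (T / N)) ^ k) * ∫⁻ ω, ENNReal.ofReal (V (ξ ω)) ∂P := by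
    induction k with
    | zero => simp [hY0]
    | succ k ih =>
      refine (hrec k).trans ((mul_le_mul_right ih _).trans_eq ?_)
      rw [← mul_assoc, ← ENNReal.ofReal_mul (by positivity), pow_succ']
  have hexp : (1 + D * (T / N)) ^ n ≤ Real.exp (D * T) :=
    calc (1 + D * (T / N)) ^ n ≤ (1 + D * (T / N)) ^ N :=
          pow_le_pow_right₀ (by have := mul_nonneg hD hh; linarith) hn
      _ ≤ Real.exp (D * (T / N)) ^ N := by
          gcongr
          linarith [Real.add_one_le_exp (D * (T / N))]
      _ = Real.exp (D * T) := by
          rw [← Real.exp_nat_mul]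
          congr 1
          field_simp
  have hpV (y : Vec d) : ‖y‖ ^ p ≤ V y := by
    refine le_trans ?_ (hVlow y)
    have h1 : (1 : ℝ) ≤ 1 + ‖y‖ ^ 2 := by linarith [sq_nonneg ‖y‖]
    calc ‖y‖ ^ p ≤ (1 + ‖y‖ ^ 2) ^ p := by
          gcongr
          nlinarith [sq_nonneg (‖y‖ - 1)]
      _ ≤ (1 + ‖y‖ ^ 2) ^ (q : ℝ) := Real.rpow_le_rpow_of_exponent_le h1 hq
      _ = _ := Real.rpow_natCast _ _
  calc ∫⁻ ω, ENNReal.ofReal (‖Y n ω‖ ^ p) ∂P ≤ ∫⁻ ω, ENNReal.ofReal (V (Y n ω)) ∂P :=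
        lintegral_mono fun ω => ENNReal.ofReal_le_ofReal (hpV _)
    _ ≤ ENNReal.ofReal ((1 + D * (T / N)) ^ n) * ∫⁻ ω, ENNReal.ofReal (V (ξ ω)) ∂P := hiter n
    _ ≤ ENNReal.ofReal (Real.exp (D * T)) * ∫⁻ x, ENNReal.ofReal ((1 + ‖x‖ ^ 2) ^ Q) ∂μξ := by
        rw [← hξlaw, lintegral_map (by fun_prop) hξ]
        gcongr
        exact hVup _
    _ = ENNReal.ofReal (Real.exp (D * T) * ∫ x, (1 + ‖x‖ ^ 2) ^ Q ∂μξ) := by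
        rw [ENNReal.ofReal_mul (by positivity), ofReal_integral_eq_lintegral_ofReal hmom
          (.of_forall fun x => by positivity)]
end
end
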